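/- arXiv:2012.05851 — 8 statements merged into one kernel-verified Lean document; each statement's English description precedes it below -/
import Mathlib

section
/- For every integer n ≥ 3 and every convex polygon P in ℝ² with exactly n vertices, area(P)/perimeter(P)² ≤ 1/(4 n tan(π/n)), and equality holds if and only if P is a regular n-gon. In particular, the scale-invariant functional f(P) = area(P)/perimeter(P)² is uniquely maximized among convex n-gons by the regular n-gons. -/
open Real MeasureTheory

/-- A convex `n`-gon: a compact convex subset of the plane which is the convex hull of a
finite set and whose set of extreme points has exactly `n` elements. -/
def IsConvexNGon (n : ℕ) (P : Set (EuclideanSpace ℝ (Fin 2))) : Prop :=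
  IsCompact P ∧ Convex ℝ P ∧ (∃ S : Finset (EuclideanSpace ℝ (Fin 2)), P = convexHull ℝ ↑S) ∧
    (Set.extremePoints ℝ P).ncard = n

/-- The area of a planar region: its two-dimensional Lebesgue measure. -/
noncomputable def polygonArea (P : Set (EuclideanSpace ℝ (Fin 2))) : ℝ :=
  (volume P).toReal

/-- The perimeter of a planar region: the one-dimensional Hausdorff measure of its boundary. -/
noncomputable def polygonPerimeter (P : Set (EuclideanSpace ℝ (Fin 2))) : ℝ :=
  (μH[1] (frontier P)).toReal

/-- A regular `n`-gon: the convex hull of `n` equally spaced points on some circle of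
positive radius (equivalently, a convex `n`-gon all of whose sides have equal length and
all of whose interior angles are equal). -/
def IsRegularNGon (n : ℕ) (P : Set (EuclideanSpace ℝ (Fin 2))) : Prop :=
  ∃ (c : EuclideanSpace ℝ (Fin 2)) (r θ : ℝ), 0 < r ∧
    P = convexHull ℝ (Set.range fun k : Fin n =>
      c + r • (WithLp.equiv 2 (Fin 2 → ℝ)).symm
        ![Real.cos (θ + 2 * π * k / n), Real.sin (θ + 2 * π * k / n)])

/-- The Euclidean plane. -/
abbrev Plane := EuclideanSpace ℝ (Fin 2)

/-- Twice the signed area of the triangle `a b c`. -/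
def cross (a b c : Plane) : ℝ := (b 0 - a 0) * (c 1 - a 1) - (b 1 - a 1) * (c 0 - a 0)

lemma cross_rotate (a b c : Plane) : cross b c a = cross a b c := by
  unfold cross; ring

lemma cross_swap (a b c : Plane) : cross b a c = -cross a b c := by
  unfold cross; ring

@[simp] lemma cross_left (a b : Plane) : cross a b a = 0 := by
  unfold cross; ring

@[simp] lemma cross_self_left (a b : Plane) : cross a a b = 0 := by
  unfold cross; ring

@[simp] lemma cross_right (a b : Plane) : cross a b b = 0 := by
  unfold cross; ring

lemma cross_add_cross_add_cross (a b c x : Plane) :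
    cross a b x + cross b c x + cross c a x = cross a b c := by
  unfold cross; ring

lemma continuous_cross (a b : Plane) : Continuous (cross a b) := by
  unfold cross; fun_prop

lemma cross_sum {ι : Type*} (s : Finset ι) (a b : Plane) (w : ι → ℝ) (x : ι → Plane)
    (hw : ∑ i ∈ s, w i = 1) :
    cross a b (∑ i ∈ s, w i • x i) = ∑ i ∈ s, w i * cross a b (x i) := by
  have h : ∀ c : Plane, cross a b c = ((b 0 - a 0) * c 1 - (b 1 - a 1) * c 0)
      - ((b 0 - a 0) * a 1 - (b 1 - a 1) * a 0) := fun c => by unfold cross; ring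
  simp only [h, mul_sub, Finset.sum_sub_distrib, ← Finset.sum_mul, hw, one_mul]
  congr 1
  simp only [WithLp.ofLp_sum, WithLp.ofLp_smul, Finset.sum_apply, Pi.smul_apply, smul_eq_mul,
    Finset.mul_sum, ← Finset.sum_sub_distrib]
  refine Finset.sum_congr rfl fun i _ => ?_
  ring

lemma cross_combo (a b x y : Plane) {s t : ℝ} (h : s + t = 1) :
    cross a b (s • x + t • y) = s * cross a b x + t * cross a b y := by
  obtain rfl : s = 1 - t := by linarith
  simp [cross]; ring

lemma convex_cross_nonneg (a b : Plane) : Convex ℝ {x | 0 ≤ cross a b x} := by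
  intro x hx y hy s t hs ht hst
  change 0 ≤ cross a b x at hx
  change 0 ≤ cross a b y at hy
  change 0 ≤ cross a b _
  rw [cross_combo _ _ _ _ hst]
  positivity

lemma mem_triangle {a b c x : Plane} (h : 0 < cross a b c) (hab : 0 ≤ cross a b x)
    (hbc : 0 ≤ cross b c x) (hca : 0 ≤ cross c a x) : x ∈ convexHull ℝ {a, b, c} := by
  have hsum := cross_add_cross_add_cross a b c x
  refine mem_convexHull_of_exists_fintype (R := ℝ)
    ![cross b c x / cross a b c, cross c a x / cross a b c, cross a b x / cross a b c]
    ![a, b, c] ?_ ?_ ?_ ?_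
  · intro i; fin_cases i <;> simp <;> positivity
  · simp only [Fin.sum_univ_three, Matrix.cons_val]
    field_simp; linarith
  · intro i; fin_cases i <;> simp
  · ext i
    fin_cases i <;> simp [Fin.sum_univ_three] <;> field_simp <;> unfold cross <;> ring

/-- The points `z 0, …, z m` are in strictly convex position, in counterclockwise order. -/
def IsCCW (m : ℕ) (z : ℕ → Plane) : Prop :=
  ∀ i j k, i < j → j < k → k ≤ m → 0 < cross (z i) (z j) (z k)

lemma IsCCW.mono {m l : ℕ} {z : ℕ → Plane} (h : IsCCW m z) (hl : l ≤ m) : IsCCW l z :=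
  fun i j k hij hjk hk => h i j k hij hjk (hk.trans hl)

/-- The convex hull of `z 0, …, z m`. -/
def hull (m : ℕ) (z : ℕ → Plane) : Set Plane := convexHull ℝ (z '' Set.Iic m)

lemma convex_hull (m : ℕ) (z : ℕ → Plane) : Convex ℝ (hull m z) := convex_convexHull _ _

lemma mem_hull {m i : ℕ} (z : ℕ → Plane) (h : i ≤ m) : z i ∈ hull m z :=
  subset_convexHull _ _ ⟨i, h, rfl⟩

lemma isCompact_hull (m : ℕ) (z : ℕ → Plane) : IsCompact (hull m z) :=
  ((Set.finite_Iic m).image z).isCompact_convexHull (𝕜 := ℝ)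

lemma hull_subset_cross_nonneg {m : ℕ} {z : ℕ → Plane} {a b : Plane}
    (h : ∀ i ≤ m, 0 ≤ cross a b (z i)) : hull m z ⊆ {x | 0 ≤ cross a b x} := by
  refine convexHull_min ?_ (convex_cross_nonneg a b)
  rintro _ ⟨i, hi, rfl⟩
  exact h i hi

lemma triangle_subset_hull {m i j k : ℕ} (z : ℕ → Plane) (hi : i ≤ m) (hj : j ≤ m) (hk : k ≤ m) :
    convexHull ℝ {z i, z j, z k} ⊆ hull m z := by
  refine convexHull_min ?_ (convex_hull m z)
  rintro _ (rfl | rfl | rfl) <;> apply mem_hull <;> assumption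

lemma IsCCW.cross_pos {m k i : ℕ} {z : ℕ → Plane} (h : IsCCW m z) (hk : k < m) (hi : i ≤ m)
    (hik : i ≠ k) (hik' : i ≠ k + 1) : 0 < cross (z k) (z (k + 1)) (z i) := by
  rcases lt_or_gt_of_ne hik with h1 | h1
  · rw [cross_rotate]; exact h i k (k + 1) h1 (by omega) (by omega)
  · exact h k (k + 1) i (by omega) (by omega) (by omega)

lemma IsCCW.cross_last_pos {m i : ℕ} {z : ℕ → Plane} (h : IsCCW m z) (hi : i < m)
    (hi' : i ≠ 0) : 0 < cross (z m) (z 0) (z i) := by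
  rw [← cross_rotate]; exact h 0 i m (by omega) (by omega) (by omega)

lemma IsCCW.cross_nonneg {m k i : ℕ} {z : ℕ → Plane} (h : IsCCW m z) (hk : k < m) (hi : i ≤ m) :
    0 ≤ cross (z k) (z (k + 1)) (z i) := by
  by_cases h1 : i = k
  · simp [h1]
  by_cases h2 : i = k + 1
  · simp [h2]
  exact (h.cross_pos hk hi h1 h2).le

lemma IsCCW.cross_last_nonneg {m i : ℕ} {z : ℕ → Plane} (h : IsCCW m z) (hi : i ≤ m) :
    0 ≤ cross (z m) (z 0) (z i) := by
  by_cases h1 : i = 0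
  · simp [h1]
  by_cases h2 : i = m
  · simp [h2]
  exact (h.cross_last_pos (by omega) h1).le

/-- A convex polygon is the intersection of the half-planes bounded by its edges; it is covered
by the triangles of the fan at `z 0`. -/
lemma IsCCW.hull_eq {m : ℕ} {z : ℕ → Plane} (h : IsCCW m z) (hm : 2 ≤ m) :
    hull m z = {x | (∀ k < m, 0 ≤ cross (z k) (z (k + 1)) x) ∧ 0 ≤ cross (z m) (z 0) x} := by
  apply Set.Subset.antisymm
  · intro x hx
    exact ⟨fun k hk => hull_subset_cross_nonneg (fun i hi => h.cross_nonneg hk hi) hx,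
      hull_subset_cross_nonneg (fun i hi => h.cross_last_nonneg hi) hx⟩
  · rintro x ⟨hx, hx'⟩
    have key : ∃ k, 1 ≤ k ∧ k < m ∧ 0 ≤ cross (z 0) (z k) x ∧ cross (z 0) (z (k + 1)) x ≤ 0 := by
      by_contra! hc
      have : ∀ k, 1 ≤ k → k < m → 0 < cross (z 0) (z (k + 1)) x := by
        intro k hk
        induction k, hk using Nat.le_induction with
        | base => exact fun h1 => hc 1 le_rfl h1 (hx 0 (by omega))
        | succ k hk ih => exact fun h1 => hc (k + 1) (by omega) h1 (ih (by omega)).le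
      have h2 := this (m - 1) (by omega) (by omega)
      rw [show m - 1 + 1 = m by omega, cross_swap] at h2
      linarith
    obtain ⟨k, hk1, hkm, h1, h2⟩ := key
    refine triangle_subset_hull z (Nat.zero_le m) hkm.le hkm
      (mem_triangle (h 0 k (k + 1) (by omega) (by omega) hkm) h1 (hx k hkm) ?_)
    rw [cross_swap]; linarith

lemma volume_line {a b : Plane} (hab : a ≠ b) : volume {x | cross a b x = 0} = 0 := by
  let l : Plane →L[ℝ] ℝ := (b 0 - a 0) • EuclideanSpace.proj 1 - (b 1 - a 1) • EuclideanSpace.proj 0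
  have hl : ∀ x : Plane, l x = (b 0 - a 0) * x 1 - (b 1 - a 1) * x 0 := fun x => by simp [l]
  have h : {x | cross a b x = 0}
      = (fun x => x - a) ⁻¹' (LinearMap.ker l.toLinearMap : Set Plane) := by
    ext x
    simp [hl, cross]
  simp only [h, sub_eq_add_neg, measure_preimage_add_right]
  refine Measure.addHaar_submodule _ _ fun htop => hab ?_
  have h0 : ∀ x, l x = 0 := fun x => by
    have : x ∈ LinearMap.ker l.toLinearMap := htop ▸ Submodule.mem_top
    simpa using this
  have h1 := h0 (EuclideanSpace.single 0 1)
  have h2 := h0 (EuclideanSpace.single 1 1)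
  rw [hl] at h1 h2
  simp at h1 h2
  ext i
  fin_cases i <;> simp <;> linarith

lemma volume_stdTriangle :
    volume {p : Plane | 0 ≤ p 0 ∧ 0 ≤ p 1 ∧ p 0 + p 1 ≤ 1} = ENNReal.ofReal (1 / 2) := by
  let T : Set (ℝ × ℝ) := {p | 0 ≤ p.1 ∧ 0 ≤ p.2 ∧ p.1 + p.2 ≤ 1}
  have hT : MeasurableSet T := by
    have : IsClosed T := by
      refine (isClosed_le continuous_const continuous_fst).inter
        ((isClosed_le continuous_const continuous_snd).inter
          (isClosed_le (continuous_fst.add continuous_snd) continuous_const))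
    exact this.measurableSet
  have h1 := (volume_preserving_finTwoArrow ℝ).comp (PiLp.volume_preserving_ofLp (Fin 2))
  have h2 := h1.measure_preimage hT.nullMeasurableSet
  refine h2.trans ?_
  rw [Measure.volume_eq_prod, Measure.prod_apply hT]
  have h3 : ∀ x : ℝ, volume (Prod.mk x ⁻¹' T)
      = (Set.Icc 0 1).indicator (fun x => ENNReal.ofReal (1 - x)) x := by
    intro x
    by_cases hx : x ∈ Set.Icc (0 : ℝ) 1
    · rw [Set.indicator_of_mem hx]
      have : Prod.mk x ⁻¹' T = Set.Icc 0 (1 - x) := by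
        ext y
        change (0 ≤ x ∧ 0 ≤ y ∧ x + y ≤ 1) ↔ _ ∧ _
        have := hx.1
        constructor
        · rintro ⟨_, h, h'⟩; exact ⟨h, by linarith⟩
        · rintro ⟨h, h'⟩; exact ⟨this, h, by linarith⟩
      rw [this, Real.volume_Icc, sub_zero]
    · rw [Set.indicator_of_notMem hx]
      have : Prod.mk x ⁻¹' T = ∅ := by
        ext y
        change (0 ≤ x ∧ 0 ≤ y ∧ x + y ≤ 1) ↔ False
        refine ⟨?_, False.elim⟩
        rintro ⟨h, h', h''⟩
        exact hx ⟨h, by linarith⟩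
      rw [this, measure_empty]
  simp_rw [h3]
  rw [lintegral_indicator measurableSet_Icc, ← ofReal_integral_eq_lintegral_ofReal,
    integral_Icc_eq_integral_Ioc, ← intervalIntegral.integral_of_le zero_le_one]
  · congr 1
    rw [intervalIntegral.integral_sub (by simp) (by simp)]
    simp
    norm_num
  · exact (continuous_const.sub continuous_id).integrableOn_Icc
  · filter_upwards [ae_restrict_mem measurableSet_Icc] with x hx
    simpa using hx.2

lemma volume_triangle {a b c : Plane} (h : 0 < cross a b c) :
    volume (convexHull ℝ {a, b, c}) = ENNReal.ofReal (cross a b c / 2) := by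
  let M : Matrix (Fin 2) (Fin 2) ℝ := (cross a b c)⁻¹ •
    !![c 1 - a 1, -(c 0 - a 0); -(b 1 - a 1), b 0 - a 0]
  let f : Plane →ₗ[ℝ] Plane := Matrix.toLpLin 2 2 M
  have hf0 : ∀ x, f (x - a) 0 = cross c a x / cross a b c := fun x => by
    simp [f, M, Matrix.toLpLin_apply, dotProduct, Fin.sum_univ_two, cross]
    ring
  have hf1 : ∀ x, f (x - a) 1 = cross a b x / cross a b c := fun x => by
    simp [f, M, Matrix.toLpLin_apply, dotProduct, Fin.sum_univ_two, cross]
    ring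
  have hdet : LinearMap.det f = (cross a b c)⁻¹ := by
    simp only [f, M, LinearMap.det_toLpLin, Matrix.det_smul, Matrix.det_fin_two_of,
      Fintype.card_fin]
    rw [sq, mul_assoc, show (c 1 - a 1) * (b 0 - a 0) - -(c 0 - a 0) * -(b 1 - a 1) = cross a b c by
      unfold cross; ring, inv_mul_cancel₀ h.ne', mul_one]
  have hset : convexHull ℝ {a, b, c} = (fun x => x - a) ⁻¹'
      (f ⁻¹' {p : Plane | 0 ≤ p 0 ∧ 0 ≤ p 1 ∧ p 0 + p 1 ≤ 1}) := by
    apply Set.Subset.antisymm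
    · have hab : convexHull ℝ {a, b, c} ⊆ {x | 0 ≤ cross a b x} := by
        refine convexHull_min ?_ (convex_cross_nonneg a b)
        rintro _ (rfl | rfl | rfl) <;> simp [h.le]
      have hbc : convexHull ℝ {a, b, c} ⊆ {x | 0 ≤ cross b c x} := by
        refine convexHull_min ?_ (convex_cross_nonneg b c)
        rintro x (rfl | rfl | rfl)
        · change 0 ≤ cross b c x
          rw [cross_rotate]; exact h.le
        · simp
        · simp
      have hca : convexHull ℝ {a, b, c} ⊆ {x | 0 ≤ cross c a x} := by
        refine convexHull_min ?_ (convex_cross_nonneg c a)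
        rintro x (rfl | rfl | rfl)
        · simp
        · change 0 ≤ cross c a x
          rw [← cross_rotate]; exact h.le
        · simp
      intro x hx
      have h1 : 0 ≤ cross a b x := hab hx
      have h2 : 0 ≤ cross b c x := hbc hx
      have h3 : 0 ≤ cross c a x := hca hx
      have := cross_add_cross_add_cross a b c x
      change 0 ≤ f (x - a) 0 ∧ 0 ≤ f (x - a) 1 ∧ f (x - a) 0 + f (x - a) 1 ≤ 1
      rw [hf0, hf1, ← add_div, div_le_one h]
      exact ⟨by positivity, by positivity, by linarith⟩
    · intro x hx
      change 0 ≤ f (x - a) 0 ∧ 0 ≤ f (x - a) 1 ∧ f (x - a) 0 + f (x - a) 1 ≤ 1 at hx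
      rw [hf0, hf1, ← add_div, div_le_one h, le_div_iff₀ h, le_div_iff₀ h, zero_mul] at hx
      have := cross_add_cross_add_cross a b c x
      exact mem_triangle h hx.2.1 (by linarith) hx.1
  simp only [hset, sub_eq_add_neg, measure_preimage_add_right]
  rw [Measure.addHaar_preimage_linearMap _ (by rw [hdet]; positivity), hdet, volume_stdTriangle,
    inv_inv, abs_of_pos h, ← ENNReal.ofReal_mul h.le]
  congr 1
  ring

lemma IsCCW.hull_succ {m : ℕ} {z : ℕ → Plane} (h : IsCCW (m + 1) z) (hm : 2 ≤ m) :
    hull (m + 1) z = hull m z ∪ convexHull ℝ {z 0, z m, z (m + 1)} := by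
  apply Set.Subset.antisymm
  · intro x hx
    rw [h.hull_eq (by omega)] at hx
    by_cases hc : 0 ≤ cross (z 0) (z m) x
    · right
      exact mem_triangle (h 0 m (m + 1) (by omega) (by omega) le_rfl) hc (hx.1 m (by omega)) hx.2
    · left
      rw [(h.mono (Nat.le_succ m)).hull_eq hm]
      refine ⟨fun k hk => hx.1 k (by omega), ?_⟩
      rw [cross_swap]; linarith
  · refine Set.union_subset ?_ (triangle_subset_hull z (by omega) (by omega) le_rfl)
    exact convexHull_mono (Set.image_mono (Set.Iic_subset_Iic.2 (Nat.le_succ m)))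

lemma IsCCW.volume_hull {m : ℕ} {z : ℕ → Plane} (h : IsCCW m z) (hm : 2 ≤ m) :
    volume (hull m z)
      = ENNReal.ofReal (∑ k ∈ Finset.range m, cross (z 0) (z k) (z (k + 1)) / 2) := by
  induction m, hm using Nat.le_induction with
  | base =>
    have : z '' Set.Iic 2 = {z 0, z 1, z 2} := by
      rw [show Set.Iic 2 = {0, 1, 2} by ext i; simp; omega]
      simp [Set.image_insert_eq]
    rw [hull, this, volume_triangle (h 0 1 2 (by omega) (by omega) le_rfl)]
    simp [Finset.sum_range_succ]
  | succ m hm ih =>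
    have h' := h.mono (Nat.le_succ m)
    have hpos := h 0 m (m + 1) (by omega) (by omega) le_rfl
    have hne : z 0 ≠ z m := by
      intro h0
      rw [h0] at hpos
      simp [cross] at hpos
    rw [h.hull_succ hm, measure_union₀, ih h', volume_triangle hpos, Finset.sum_range_succ,
      ENNReal.ofReal_add _ (by positivity)]
    · refine Finset.sum_nonneg fun k hk => ?_
      have hk := Finset.mem_range.1 hk
      have : 0 ≤ cross (z 0) (z k) (z (k + 1)) := by
        rw [← cross_rotate]
        exact h'.cross_nonneg hk (Nat.zero_le m)
      positivity
    · exact ((Set.toFinite _).isCompact_convexHull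
        (𝕜 := ℝ)).isClosed.measurableSet.nullMeasurableSet
    · refine measure_mono_null ?_ (volume_line hne)
      rintro x ⟨hx1, hx2⟩
      rw [h'.hull_eq hm] at hx1
      have h1 := hx1.2
      have h2 : 0 ≤ cross (z 0) (z m) x := by
        refine convexHull_min (s := {z 0, z m, z (m + 1)}) ?_ (convex_cross_nonneg _ _) hx2
        rintro _ (rfl | rfl | rfl) <;> simp [hpos.le]
      rw [cross_swap] at h1
      exact le_antisymm (by linarith) h2

lemma isOpen_cross_pos (a b : Plane) : IsOpen {x | 0 < cross a b x} :=
  isOpen_lt continuous_const (continuous_cross a b)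

/-- A boundary point of a half-plane is not interior to it. -/
lemma notMem_interior_of_cross_eq_zero {a b x : Plane} {s : Set Plane} (hab : a ≠ b)
    (hs : ∀ y ∈ s, 0 ≤ cross a b y) (hx : cross a b x = 0) : x ∉ interior s := by
  intro hi
  let v : Plane := !₂[b 1 - a 1, -(b 0 - a 0)]
  have hc : Filter.Tendsto (fun t : ℝ => x + t • v) (nhdsWithin 0 (Set.Ioi 0)) (nhds x) := by
    have : Continuous fun t : ℝ => x + t • v := by fun_prop
    simpa using (this.tendsto 0).mono_left nhdsWithin_le_nhds
  have hev := hc.eventually (mem_interior_iff_mem_nhds.1 hi)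
  obtain ⟨t, ht, ht0⟩ := (hev.and self_mem_nhdsWithin).exists
  have h1 := hs _ ht
  have h2 : cross a b (x + t • v) = cross a b x - t * ((b 0 - a 0) ^ 2 + (b 1 - a 1) ^ 2) := by
    simp [cross, v]; ring
  have h3 : 0 < (b 0 - a 0) ^ 2 + (b 1 - a 1) ^ 2 := by
    by_contra! hle
    refine hab ?_
    ext i
    fin_cases i <;> simp <;> nlinarith [sq_nonneg (b 0 - a 0), sq_nonneg (b 1 - a 1)]
  rw [h2, hx] at h1
  have := mul_pos (show (0 : ℝ) < t from ht0) h3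
  linarith

/-- The face of a convex hull cut out by a supporting line through two of its generators. -/
lemma mem_segment_of_cross_eq_zero {a b x : Plane} {s : Finset Plane}
    (hs : ∀ y ∈ s, y ≠ a → y ≠ b → 0 < cross a b y) (hx : x ∈ convexHull ℝ (s : Set Plane))
    (hx0 : cross a b x = 0) : x ∈ segment ℝ a b := by
  rw [Finset.mem_convexHull'] at hx
  obtain ⟨w, hw0, hw1, rfl⟩ := hx
  rw [cross_sum _ _ _ _ _ hw1, Finset.sum_eq_zero_iff_of_nonneg] at hx0
  · rw [← convexHull_pair]
    have hmem : ∀ y ∈ s, w y ≠ 0 → y ∈ ({a, b} : Set Plane) := by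
      intro y hy hwy
      by_contra hne
      simp only [Set.mem_insert_iff, Set.mem_singleton_iff, not_or] at hne
      exact (mul_ne_zero hwy (hs y hy hne.1 hne.2).ne') (hx0 y hy)
    have h1 : ∑ y ∈ s with w y ≠ 0, w y = 1 := by
      rw [Finset.sum_filter_ne_zero, hw1]
    have h2 : ∑ y ∈ s with w y ≠ 0, w y • y = ∑ y ∈ s, w y • y := by
      refine Finset.sum_filter_of_ne fun y _ h => ?_
      exact fun h0 => h (by rw [h0, zero_smul])
    rw [← h2]
    refine (convex_convexHull ℝ _).sum_mem (fun y hy => hw0 y (Finset.mem_filter.1 hy).1) h1 ?_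
    intro y hy
    exact subset_convexHull _ _ (hmem y (Finset.mem_filter.1 hy).1 (Finset.mem_filter.1 hy).2)
  · intro y hy
    refine mul_nonneg (hw0 y hy) ?_
    by_cases h1 : y = a
    · simp [h1]
    by_cases h2 : y = b
    · simp [h2]
    exact (hs y hy h1 h2).le

lemma IsCCW.ne {m i j : ℕ} {z : ℕ → Plane} (h : IsCCW m z) (hm : 2 ≤ m) (hij : i < j)
    (hj : j ≤ m) : z i ≠ z j := by
  intro he
  obtain ⟨k, hk, hki, hkj⟩ : ∃ k ≤ m, k ≠ i ∧ k ≠ j := by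
    by_cases h0 : i = 0
    · by_cases h1 : j = 1
      · exact ⟨2, hm, by omega, by omega⟩
      · exact ⟨1, by omega, by omega, by omega⟩
    · exact ⟨0, by omega, by omega, by omega⟩
  have hpos : ∀ c, cross (z i) (z j) c = 0 := fun c => by rw [he, cross_self_left]
  rcases lt_or_gt_of_ne hki with h1 | h1
  · have := h k i j h1 hij hj
    rw [← cross_rotate, hpos] at this
    exact this.false
  rcases lt_or_gt_of_ne hkj with h2 | h2
  · have := h i k j h1 h2 hj
    rw [← cross_rotate, ← cross_rotate, cross_swap, hpos] at this
    simp at this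
  · have := h i j k hij h2 hk
    rw [hpos] at this
    exact this.false

/-- Index of the vertex following `k` among `0, …, m`. -/
def next (m k : ℕ) : ℕ := if k = m then 0 else k + 1

lemma next_le {m k : ℕ} (hk : k ≤ m) : next m k ≤ m := by
  unfold next; split_ifs <;> omega

lemma IsCCW.cross_next_pos {m k i : ℕ} {z : ℕ → Plane} (h : IsCCW m z) (hk : k ≤ m) (hi : i ≤ m)
    (hik : i ≠ k) (hik' : i ≠ next m k) : 0 < cross (z k) (z (next m k)) (z i) := by
  unfold next at *
  split_ifs at * with h1
  · subst h1
    exact h.cross_last_pos (by omega) hik'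
  · exact h.cross_pos (by omega) hi hik hik'

lemma IsCCW.cross_next_nonneg {m k : ℕ} {z : ℕ → Plane} (h : IsCCW m z) (hm : 2 ≤ m) (hk : k ≤ m)
    {x : Plane} (hx : x ∈ hull m z) : 0 ≤ cross (z k) (z (next m k)) x := by
  rw [h.hull_eq hm] at hx
  unfold next
  split_ifs with h1
  · subst h1; exact hx.2
  · exact hx.1 k (by omega)

lemma IsCCW.ne_next {m k : ℕ} {z : ℕ → Plane} (h : IsCCW m z) (hm : 2 ≤ m) (hk : k ≤ m) :
    z k ≠ z (next m k) := by
  unfold next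
  split_ifs with h1
  · subst h1; exact (h.ne hm (by omega) le_rfl).symm
  · exact h.ne hm (by omega) (by omega)

lemma IsCCW.mem_segment {m k : ℕ} {z : ℕ → Plane} (h : IsCCW m z) (hk : k ≤ m)
    {x : Plane} (hx : x ∈ hull m z) (hx0 : cross (z k) (z (next m k)) x = 0) :
    x ∈ segment ℝ (z k) (z (next m k)) := by
  classical
  refine mem_segment_of_cross_eq_zero (s := (Finset.Iic m).image z) ?_
    (by simpa [hull] using hx) hx0
  intro y hy hy1 hy2
  obtain ⟨i, hi, rfl⟩ := Finset.mem_image.1 hy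
  exact h.cross_next_pos hk (Finset.mem_Iic.1 hi) (fun he => hy1 (by rw [he]))
    (fun he => hy2 (by rw [← he]))

lemma IsCCW.frontier_hull {m : ℕ} {z : ℕ → Plane} (h : IsCCW m z) (hm : 2 ≤ m) :
    frontier (hull m z) = ⋃ k ∈ Finset.Iic m, segment ℝ (z k) (z (next m k)) := by
  rw [(isCompact_hull m z).isClosed.frontier_eq]
  apply Set.Subset.antisymm
  · rintro x ⟨hx, hx'⟩
    simp only [Set.mem_iUnion, Finset.mem_Iic, exists_prop]
    by_contra! hc
    refine hx' (mem_interior.2 ⟨⋂ k ∈ Finset.Iic m, {y | 0 < cross (z k) (z (next m k)) y},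
      ?_, ?_, ?_⟩)
    · intro y hy
      simp only [Set.mem_iInter, Finset.mem_Iic] at hy
      rw [h.hull_eq hm]
      refine ⟨fun k hk => ?_, ?_⟩
      · have := hy k hk.le
        rw [next, if_neg hk.ne] at this
        exact le_of_lt this
      · have := hy m le_rfl
        rw [next, if_pos rfl] at this
        exact le_of_lt this
    · exact isOpen_biInter_finset fun k _ => isOpen_cross_pos _ _
    · simp only [Set.mem_iInter, Finset.mem_Iic]
      intro k hk
      refine lt_of_le_of_ne (h.cross_next_nonneg hm hk hx) fun h0 => ?_
      exact hc k hk (h.mem_segment hk hx h0.symm)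
  · simp only [Set.iUnion_subset_iff, Finset.mem_Iic]
    intro k hk x hx
    refine ⟨(convex_hull m z).segment_subset (mem_hull z hk) (mem_hull z (next_le hk)) hx, ?_⟩
    refine notMem_interior_of_cross_eq_zero (h.ne_next hm hk)
      (fun y hy => h.cross_next_nonneg hm hk hy) ?_
    obtain ⟨s, t, _, _, hst, rfl⟩ := hx
    rw [cross_combo _ _ _ _ hst, cross_left, cross_right]
    simp

lemma IsCCW.hausdorffMeasure_frontier {m : ℕ} {z : ℕ → Plane} (h : IsCCW m z) (hm : 2 ≤ m) :
    μH[1] (frontier (hull m z))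
      = ENNReal.ofReal (∑ k ∈ Finset.Iic m, dist (z k) (z (next m k))) := by
  rw [h.frontier_hull hm, measure_biUnion_finset₀]
  · rw [ENNReal.ofReal_sum_of_nonneg fun _ _ => dist_nonneg]
    refine Finset.sum_congr rfl fun k _ => ?_
    rw [hausdorffMeasure_segment, edist_dist]
  · intro k hk j hj hkj
    have hk' : k ≤ m := by simpa using hk
    have hj' : j ≤ m := by simpa using hj
    refine measure_mono_null (t := {z k, z (next m k)}) ?_ ?_
    · rintro x ⟨hxk, hxj⟩
      have hj0 : cross (z j) (z (next m j)) x = 0 := by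
        obtain ⟨s, t, _, _, hst, rfl⟩ := hxj
        rw [cross_combo _ _ _ _ hst, cross_left, cross_right]
        simp
      obtain ⟨s, t, hs, ht, hst, rfl⟩ := hxk
      have h1 := h.cross_next_nonneg hm hj' (mem_hull z hk')
      have h2 := h.cross_next_nonneg hm hj' (mem_hull z (next_le hk'))
      rw [cross_combo _ _ _ _ hst] at hj0
      have h3 : 0 < cross (z j) (z (next m j)) (z k) ∨
          0 < cross (z j) (z (next m j)) (z (next m k)) := by
        by_cases hc : k = next m j
        · right
          refine h.cross_next_pos hj' (next_le hk') ?_ ?_ <;> unfold next at * <;>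
            split_ifs at * <;> omega
        · left
          exact h.cross_next_pos hj' hk' hkj hc
      have h4 := mul_nonneg hs h1
      have h5 := mul_nonneg ht h2
      rcases h3 with h3 | h3
      · have hs0 : s = 0 := (mul_eq_zero.1 (by linarith : s * _ = 0)).resolve_right h3.ne'
        have ht1 : t = 1 := by linarith
        simp [hs0, ht1]
      · have ht0 : t = 0 := (mul_eq_zero.1 (by linarith : t * _ = 0)).resolve_right h3.ne'
        have hs1 : s = 1 := by linarith
        simp [ht0, hs1]
    · have := Measure.nullSingletonClass_hausdorff Plane (d := 1) one_pos
      exact (Set.toFinite _).measure_zero _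
  · intro k _
    rw [← convexHull_pair]
    exact ((Set.toFinite _).isCompact_convexHull (𝕜 := ℝ)).isClosed.measurableSet.nullMeasurableSet

/-- A finite set of at least two points, none of which lies in the convex hull of the others,
can be listed in counterclockwise order. -/
lemma exists_isCCW {m : ℕ} (V : Finset Plane) (hV : V.card = m + 1)
    (hconv : ∀ v ∈ V, v ∉ convexHull ℝ ((V : Set Plane) \ {v})) :
    ∃ z, IsCCW m z ∧ z '' Set.Iic m = V := by
  classical
  obtain ⟨p, hp, hmax⟩ := V.exists_max_image (fun v => ‖v‖ ^ 2) (Finset.card_pos.1 (by omega))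
  have hnorm : ∀ v : Plane, ‖v‖ ^ 2 = v 0 ^ 2 + v 1 ^ 2 := fun v => by
    rw [EuclideanSpace.real_norm_sq_eq, Fin.sum_univ_two]
  let f : Plane → ℝ := fun v => p 0 * (p 0 - v 0) + p 1 * (p 1 - v 1)
  let g : Plane → ℝ := fun v => p 0 * (p 1 - v 1) - p 1 * (p 0 - v 0)
  have hfpos : ∀ v ∈ V.erase p, 0 < f v := by
    intro v hv
    obtain ⟨hvp, hv⟩ := Finset.mem_erase.1 hv
    have h1 := hmax v hv
    simp only [hnorm] at h1
    have h2 : 0 < (p 0 - v 0) ^ 2 + (p 1 - v 1) ^ 2 := by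
      by_contra! hle
      refine hvp ?_
      ext i
      fin_cases i <;> simp <;> nlinarith [sq_nonneg (p 0 - v 0), sq_nonneg (p 1 - v 1)]
    simp only [f]
    nlinarith
  have hcross : ∀ a b, f a * g b - g a * f b = (p 0 ^ 2 + p 1 ^ 2) * cross p a b := by
    intro a b
    simp only [f, g, cross]; ring
  have hp0 : ∀ v ∈ V.erase p, 0 < p 0 ^ 2 + p 1 ^ 2 := by
    intro v hv
    by_contra! hle
    have h0 : p 0 = 0 := by nlinarith [sq_nonneg (p 0), sq_nonneg (p 1)]
    have h1 : p 1 = 0 := by nlinarith [sq_nonneg (p 0), sq_nonneg (p 1)]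
    have := hfpos v hv
    simp [f, h0, h1] at this
  have hlt : ∀ a ∈ V.erase p, ∀ b ∈ V.erase p, g a / f a < g b / f b → 0 < cross p a b := by
    intro a ha b hb hab
    rw [div_lt_div_iff₀ (hfpos a ha) (hfpos b hb)] at hab
    refine pos_of_mul_pos_right (a := p 0 ^ 2 + p 1 ^ 2) ?_ (hp0 a ha).le
    rw [← hcross]; linarith
  have hray : ∀ a ∈ V.erase p, ∀ b ∈ V.erase p, g a / f a = g b / f b → f a ≤ f b → a = b := by
    intro a ha b hb hab hle
    by_contra hne
    have hfa := hfpos a ha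
    have hfb := hfpos b hb
    rw [div_eq_div_iff hfa.ne' hfb.ne'] at hab
    refine hconv a (Finset.mem_of_mem_erase ha) ?_
    have hmem : a ∈ segment ℝ p b := by
      refine ⟨1 - f a / f b, f a / f b, ?_, by positivity, by ring, ?_⟩
      · rw [sub_nonneg, div_le_one hfb]; exact hle
      · have hpp := hp0 a ha
        have e0 : (p 0 ^ 2 + p 1 ^ 2) * (f b * (p 0 - a 0) - f a * (p 0 - b 0)) = 0 := by
          have : (p 0 ^ 2 + p 1 ^ 2) * (f b * (p 0 - a 0) - f a * (p 0 - b 0))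
              = p 1 * (g b * f a - g a * f b) := by simp only [f, g]; ring
          rw [this, hab]; ring
        have e1 : (p 0 ^ 2 + p 1 ^ 2) * (f b * (p 1 - a 1) - f a * (p 1 - b 1)) = 0 := by
          have : (p 0 ^ 2 + p 1 ^ 2) * (f b * (p 1 - a 1) - f a * (p 1 - b 1))
              = p 0 * (g a * f b - g b * f a) := by simp only [f, g]; ring
          rw [this, hab]; ring
        have e0 := (mul_eq_zero.1 e0).resolve_left hpp.ne'
        have e1 := (mul_eq_zero.1 e1).resolve_left hpp.ne'
        ext i
        fin_cases i
        · simp only [Fin.zero_eta, PiLp.add_apply, PiLp.smul_apply, smul_eq_mul]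
          field_simp; linarith
        · simp only [Fin.mk_one, PiLp.add_apply, PiLp.smul_apply, smul_eq_mul]
          field_simp; linarith
    refine (convex_convexHull ℝ _).segment_subset (subset_convexHull _ _ ?_)
      (subset_convexHull _ _ ?_) hmem
    · exact ⟨hp, fun h => (Finset.ne_of_mem_erase ha) h.symm⟩
    · exact ⟨Finset.mem_of_mem_erase hb, fun h => hne h.symm⟩
  have hinj : Set.InjOn (fun v => g v / f v) (V.erase p : Set Plane) := by
    intro a ha b hb hab
    rcases le_total (f a) (f b) with h | h
    · exact hray a ha b hb hab h
    · exact (hray b hb a ha hab.symm h).symm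
  have hcard : ((V.erase p).image fun v => g v / f v).card = m := by
    rw [Finset.card_image_of_injOn hinj, Finset.card_erase_of_mem hp, hV]; rfl
  let e := Finset.orderEmbOfFin _ hcard
  have hy : ∀ i, ∃ v ∈ V.erase p, g v / f v = e i := fun i =>
    Finset.mem_image.1 (Finset.orderEmbOfFin_mem _ hcard i)
  choose y hyV hye using hy
  have hysurj : ∀ v ∈ V.erase p, ∃ i, y i = v := by
    intro v hv
    have : g v / f v ∈ Set.range e := by
      rw [Finset.range_orderEmbOfFin]
      exact Finset.mem_coe.2 (Finset.mem_image_of_mem _ hv)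
    obtain ⟨i, hi⟩ := this
    exact ⟨i, hinj (hyV i) hv ((hye i).trans hi)⟩
  have hypos : ∀ i j, i < j → 0 < cross p (y i) (y j) := fun i j hij =>
    hlt _ (hyV i) _ (hyV j) (by rw [hye, hye]; exact e.strictMono hij)
  let z : ℕ → Plane := fun k => if h : k - 1 < m ∧ k ≠ 0 then y ⟨k - 1, h.1⟩ else p
  have hz0 : z 0 = p := by simp [z]
  have hzs : ∀ k (h : k < m), z (k + 1) = y ⟨k, h⟩ := fun k h => by simp [z, h]
  have hzV : ∀ k, z k ∈ V := fun k => by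
    simp only [z]
    split_ifs
    · exact Finset.mem_of_mem_erase (hyV _)
    · exact hp
  have hz0pos : ∀ j k, 0 < j → j < k → k ≤ m → 0 < cross (z 0) (z j) (z k) := by
    intro j k h0 hjk hk
    obtain ⟨j, rfl⟩ := Nat.exists_eq_succ_of_ne_zero h0.ne'
    obtain ⟨k, rfl⟩ := Nat.exists_eq_succ_of_ne_zero (by omega : k ≠ 0)
    rw [Nat.succ_eq_add_one, Nat.succ_eq_add_one, hz0, hzs j (by omega), hzs k (by omega)]
    exact hypos _ _ (Fin.mk_lt_mk.2 (by omega))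
  refine ⟨z, ?_, ?_⟩
  · intro i j k hij hjk hk
    rcases Nat.eq_zero_or_pos i with rfl | hi
    · exact hz0pos j k hij hjk hk
    by_contra! hle
    have h1 := hz0pos i j hi hij (by omega)
    have h2 := hz0pos j k (by omega) hjk hk
    have h3 := hz0pos i k hi (by omega) hk
    refine hconv (z j) (hzV j) (convexHull_mono ?_ (mem_triangle h3 h1.le ?_ ?_))
    · rintro x (rfl | rfl | rfl)
      · exact ⟨hzV 0, fun h => by rw [← Set.mem_singleton_iff.1 h] at h2; simp at h2⟩
      · exact ⟨hzV i, fun h => by rw [← Set.mem_singleton_iff.1 h] at h1; simp at h1⟩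
      · exact ⟨hzV k, fun h => by rw [← Set.mem_singleton_iff.1 h] at h2; simp at h2⟩
    · have e1 := cross_swap (z k) (z i) (z j)
      have e2 := cross_rotate (z k) (z i) (z j)
      linarith
    · rw [← cross_rotate]; exact h2.le
  · apply Set.Subset.antisymm
    · rintro _ ⟨k, _, rfl⟩
      exact hzV k
    · intro v hv
      by_cases hvp : v = p
      · exact ⟨0, Nat.zero_le m, hz0.trans hvp.symm⟩
      · obtain ⟨i, rfl⟩ := hysurj v (Finset.mem_erase.2 ⟨hvp, hv⟩)
        exact ⟨i + 1, i.2, hzs i i.2⟩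

lemma IsConvexNGon.exists_isCCW {m : ℕ} {P : Set Plane} (hP : IsConvexNGon (m + 1) P) :
    ∃ z, IsCCW m z ∧ P = hull m z := by
  obtain ⟨hcomp, hconv, ⟨S, rfl⟩, hcard⟩ := hP
  have hfin : ((convexHull ℝ (S : Set Plane)).extremePoints ℝ).Finite :=
    S.finite_toSet.subset extremePoints_convexHull_subset
  have hhull := closure_convexHull_extremePoints hcomp hconv
  rw [((hfin.isCompact_convexHull (𝕜 := ℝ)).isClosed).closure_eq] at hhull
  obtain ⟨z, hz, hzV⟩ := _root_.exists_isCCW (m := m) hfin.toFinset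
    (by rw [← Set.ncard_eq_toFinset_card _ hfin, hcard]) (by
      rw [hfin.coe_toFinset]
      have := hconv.convexIndependent_extremePoints
      rw [convexIndependent_set_iff_notMem_convexHull_sdiff] at this
      exact fun v hv => this v (hfin.mem_toFinset.1 hv))
  refine ⟨z, hz, ?_⟩
  rw [hull, hzV, hfin.coe_toFinset, hhull]

/-- Twice the signed area enclosed by the closed polygon `w`. -/
noncomputable def area₂ {n : ℕ} [NeZero n] (w : ZMod n → ℂ) : ℝ :=
  ∑ k, (starRingEnd ℂ (w k) * w (k + 1)).im

/-- The sum of the `p`-th powers of the sides of the closed polygon `w`. -/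
noncomputable def sidePow {n : ℕ} [NeZero n] (p : ℕ) (w : ZMod n → ℂ) : ℝ :=
  ∑ k, ‖w (k + 1) - w k‖ ^ p

lemma exists_fourier {n : ℕ} [NeZero n] (w : ZMod n → ℂ) :
    ∃ c : ZMod n → ℂ, ∀ k, w k = ∑ j, c j * ZMod.stdAddChar (j * k) := by
  refine ⟨fun j => (n : ℂ)⁻¹ * ZMod.dft w j, fun k => ?_⟩
  have h := congrFun (LinearEquiv.symm_apply_apply ZMod.dft w) k
  rw [ZMod.invDFT_apply] at h
  rw [← h, smul_eq_mul, Finset.mul_sum]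
  refine Finset.sum_congr rfl fun j _ => ?_
  rw [smul_eq_mul]; ring

lemma parseval_shift {n : ℕ} [NeZero n] {w c : ZMod n → ℂ}
    (hc : ∀ k, w k = ∑ j, c j * ZMod.stdAddChar (j * k)) (m : ZMod n) :
    ∑ k, starRingEnd ℂ (w k) * w (k + m)
      = n * ∑ j, (‖c j‖ ^ 2 : ℝ) * ZMod.stdAddChar (j * m) := by
  have h1 : ∀ k, starRingEnd ℂ (w k) * w (k + m) = ∑ i, ∑ j,
      (starRingEnd ℂ (c i) * c j * ZMod.stdAddChar (j * m)) * ZMod.stdAddChar (k * (j - i)) := by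
    intro k
    rw [hc k, hc (k + m), map_sum, Finset.sum_mul_sum]
    refine Finset.sum_congr rfl fun i _ => Finset.sum_congr rfl fun j _ => ?_
    rw [map_mul, ← AddChar.map_neg_eq_conj, show j * (k + m) = j * m + j * k by ring,
      AddChar.map_add_eq_mul, show k * (j - i) = -(i * k) + j * k by ring, AddChar.map_add_eq_mul]
    ring
  simp_rw [h1]
  rw [Finset.sum_comm, Finset.mul_sum]
  refine Finset.sum_congr rfl fun i _ => ?_
  rw [Finset.sum_comm]
  simp_rw [← Finset.mul_sum, AddChar.sum_mulShift _ (ZMod.isPrimitive_stdAddChar n)]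
  rw [Finset.sum_eq_single i]
  · simp only [sub_self, if_true, ZMod.card]
    rw [← Complex.normSq_eq_norm_sq, Complex.normSq_eq_conj_mul_self]
    ring
  · intro j _ hj
    rw [if_neg (sub_ne_zero.2 hj)]
    simp
  · simp

lemma stdAddChar_eq {n : ℕ} [NeZero n] (j : ZMod n) :
    ZMod.stdAddChar j = Complex.exp ((2 * (π * j.val / n) : ℝ) * Complex.I) := by
  rw [ZMod.stdAddChar_apply, ZMod.toCircle_apply]
  congr 1
  push_cast; ring

lemma eigenvalue_eq {t x : ℝ} (ht : cos t ≠ 0) :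
    1 - cos (2 * x) - tan t * sin (2 * x) = 2 * sin x * sin (x - t) / cos t := by
  rw [tan_eq_sin_div_cos, cos_two_mul, sin_two_mul, sin_sub, cos_sq']
  field_simp
  ring

lemma cos_pi_div_pos {n : ℕ} (hn : 3 ≤ n) : 0 < cos (π / n) := by
  have hn' : (3 : ℝ) ≤ n := by exact_mod_cast hn
  apply cos_pos_of_mem_Ioo
  constructor
  · have : 0 < π / n := by positivity
    linarith [pi_pos]
  · exact div_lt_div_of_pos_left pi_pos two_pos (by linarith)

lemma eigenvalue_pos {n : ℕ} (hn : 3 ≤ n) {j : ℕ} (hj : 2 ≤ j) (hjn : j < n) :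
    0 < 1 - cos (2 * (π * j / n)) - tan (π / n) * sin (2 * (π * j / n)) := by
  have hn' : (3 : ℝ) ≤ n := by exact_mod_cast hn
  have hj' : (2 : ℝ) ≤ j := by exact_mod_cast hj
  have hjn' : (j : ℝ) < n := by exact_mod_cast hjn
  rw [eigenvalue_eq (cos_pi_div_pos hn).ne']
  have h1 : π * j / n < π := by
    rw [div_lt_iff₀ (by linarith)]
    exact mul_lt_mul_of_pos_left hjn' pi_pos
  have h2 : 0 < sin (π * j / n) := sin_pos_of_pos_of_lt_pi (by positivity) h1
  have h3 : π * j / n - π / n = π * (j - 1) / n := by ring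
  have h4 : 0 < sin (π * j / n - π / n) := by
    have h5 : 0 < π / n := by positivity
    refine sin_pos_of_pos_of_lt_pi ?_ (by linarith)
    rw [h3]
    exact div_pos (mul_pos pi_pos (by linarith)) (by linarith)
  have := cos_pi_div_pos hn
  positivity

lemma eigenvalue_nonneg {n : ℕ} (hn : 3 ≤ n) {j : ℕ} (hjn : j < n) :
    0 ≤ 1 - cos (2 * (π * j / n)) - tan (π / n) * sin (2 * (π * j / n)) := by
  by_cases hj : 2 ≤ j
  · exact (eigenvalue_pos hn hj hjn).le
  · rw [eigenvalue_eq (cos_pi_div_pos hn).ne']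
    interval_cases j <;> simp

lemma sidePow_two_sub_area₂ {n : ℕ} [NeZero n] {w c : ZMod n → ℂ} (t : ℝ)
    (hc : ∀ k, w k = ∑ j, c j * ZMod.stdAddChar (j * k)) :
    sidePow 2 w - 2 * t * area₂ w = 2 * n * ∑ j : ZMod n, ‖c j‖ ^ 2 *
      (1 - cos (2 * (π * j.val / n)) - t * sin (2 * (π * j.val / n))) := by
  have h0 := congrArg Complex.re (parseval_shift hc 0)
  have h1 := parseval_shift hc 1
  have h1r := congrArg Complex.re h1
  have h1i := congrArg Complex.im h1
  simp only [mul_one, mul_zero, add_zero, AddChar.map_zero_eq_one, Complex.re_sum, Complex.im_sum,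
    ← Complex.ofReal_natCast, Complex.re_ofReal_mul, Complex.im_ofReal_mul, stdAddChar_eq,
    Complex.exp_ofReal_mul_I_re, Complex.exp_ofReal_mul_I_im, Complex.ofReal_re] at h0 h1r h1i
  have hside : sidePow 2 w = 2 * ∑ k, (starRingEnd ℂ (w k) * w k).re
      - 2 * ∑ k, (starRingEnd ℂ (w k) * w (k + 1)).re := by
    have hshift : ∑ k, (starRingEnd ℂ (w (k + 1)) * w (k + 1)).re
        = ∑ k, (starRingEnd ℂ (w k) * w k).re :=
      Equiv.sum_comp (Equiv.addRight (1 : ZMod n)) fun k => (starRingEnd ℂ (w k) * w k).re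
    rw [two_mul (∑ k, (starRingEnd ℂ (w k) * w k).re)]
    nth_rewrite 1 [← hshift]
    rw [Finset.mul_sum, ← Finset.sum_add_distrib, ← Finset.sum_sub_distrib]
    refine Finset.sum_congr rfl fun k _ => ?_
    rw [← Complex.normSq_eq_norm_sq, Complex.normSq_apply]
    simp
    ring
  rw [hside, area₂, h0, h1r, h1i]
  simp only [Finset.mul_sum, ← Finset.sum_sub_distrib]
  refine Finset.sum_congr rfl fun j _ => ?_
  ring

lemma area₂_le_sidePow_two {n : ℕ} [NeZero n] (hn : 3 ≤ n) (w : ZMod n → ℂ) :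
    2 * tan (π / n) * area₂ w ≤ sidePow 2 w := by
  obtain ⟨c, hc⟩ := exists_fourier w
  rw [← sub_nonneg, sidePow_two_sub_area₂ _ hc]
  exact mul_nonneg (by positivity) (Finset.sum_nonneg fun j _ =>
    mul_nonneg (sq_nonneg _) (eigenvalue_nonneg hn j.val_lt))

lemma eq_regular_of_area₂_eq {n : ℕ} [NeZero n] (hn : 3 ≤ n) {w : ZMod n → ℂ}
    (h : 2 * tan (π / n) * area₂ w = sidePow 2 w) :
    ∃ c r : ℂ, ∀ k, w k = c + r * ZMod.stdAddChar k := by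
  obtain ⟨c, hc⟩ := exists_fourier w
  have : Fact (1 < n) := ⟨by omega⟩
  have h0 := sidePow_two_sub_area₂ (tan (π / n)) hc
  rw [h, sub_self, eq_comm, mul_eq_zero, or_iff_right (by simp [NeZero.ne n]),
    Finset.sum_eq_zero_iff_of_nonneg fun j _ =>
      mul_nonneg (sq_nonneg _) (eigenvalue_nonneg hn j.val_lt)] at h0
  have hz : ∀ j : ZMod n, j ≠ 0 ∧ j ≠ 1 → c j = 0 := by
    rintro j ⟨hj0, hj1⟩
    have hj : 2 ≤ j.val := by
      by_contra! hlt
      have : j.val = 0 ∨ j.val = 1 := by omega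
      rcases this with h | h
      · exact hj0 ((ZMod.val_eq_zero j).1 h)
      · exact hj1 (ZMod.val_injective n (h.trans (ZMod.val_one n).symm))
    have := (mul_eq_zero.1 (h0 j (Finset.mem_univ j))).resolve_right
      (eigenvalue_pos hn hj j.val_lt).ne'
    simpa using this
  refine ⟨c 0, c 1, fun k => ?_⟩
  rw [hc, Finset.sum_eq_add 0 1 zero_ne_one (fun j _ hj => by rw [hz j hj, zero_mul])
    (by simp) (by simp)]
  simp

/-- Among the triangles on the base `a b` with given perimeter, the isosceles one has the largest
area. -/
lemma exists_isosceles {a b p : ℂ} (h : ‖p - a‖ ≠ ‖b - p‖) :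
    ∃ q : ℂ, ‖q - a‖ = (‖p - a‖ + ‖b - p‖) / 2 ∧ ‖b - q‖ = (‖p - a‖ + ‖b - p‖) / 2 ∧
      (starRingEnd ℂ (p - a) * (b - a)).im ≤ (starRingEnd ℂ (q - a) * (b - a)).im ∧
      (0 < (starRingEnd ℂ (p - a) * (b - a)).im →
        (starRingEnd ℂ (p - a) * (b - a)).im < (starRingEnd ℂ (q - a) * (b - a)).im) := by
  set u := ‖p - a‖ with hu
  set v := ‖b - p‖ with hv
  set c := ‖b - a‖ with hc
  have hab : b - a ≠ 0 := by
    intro h0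
    rw [sub_eq_zero] at h0
    rw [hu, hv, h0, norm_sub_rev] at h
    exact h rfl
  have hcpos : 0 < c := norm_pos_iff.2 hab
  have hcs : c ≤ u + v := by
    rw [hc, hu, hv, show b - a = (p - a) + (b - p) by ring]
    exact norm_add_le _ _
  have hsq : ∀ z : ℂ, ‖z‖ ^ 2 = z.re ^ 2 + z.im ^ 2 := fun z => by
    rw [← Complex.normSq_eq_norm_sq, Complex.normSq_apply]; ring
  have hu2 := hsq (p - a)
  have hv2 := hsq (b - p)
  have hc2 := hsq (b - a)
  rw [← hu] at hu2
  rw [← hv] at hv2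
  rw [← hc] at hc2
  set D := (starRingEnd ℂ (p - a) * (b - a)).im with hD
  have hD' : D = (p.re - a.re) * (b.im - a.im) - (p.im - a.im) * (b.re - a.re) := by
    simp [hD]; ring
  simp only [Complex.sub_re, Complex.sub_im] at hu2 hv2 hc2
  have hheron : 4 * D ^ 2 = ((u + v) ^ 2 - c ^ 2) * (c ^ 2 - (u - v) ^ 2) := by
    have : ((u + v) ^ 2 - c ^ 2) * (c ^ 2 - (u - v) ^ 2)
        = 4 * (u ^ 2 * v ^ 2) - (c ^ 2 - u ^ 2 - v ^ 2) ^ 2 := by ring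
    rw [this, hu2, hv2, hc2, hD']
    ring
  have hs : 0 ≤ (u + v) ^ 2 - c ^ 2 := by nlinarith
  set τ := √((u + v) ^ 2 - c ^ 2) / (2 * c) with hτ
  have hτ2 : (2 * c * τ) ^ 2 = (u + v) ^ 2 - c ^ 2 := by
    rw [hτ, mul_div_cancel₀ _ (by positivity), Real.sq_sqrt hs]
  have hτ0 : 0 ≤ τ := by positivity
  have huv : 0 ≤ (u + v) / 2 := by positivity
  refine ⟨a + (1 / 2 - τ * Complex.I) * (b - a), ?_, ?_, ?_⟩
  · rw [← abs_of_nonneg (norm_nonneg _), ← abs_of_nonneg huv, ← sq_eq_sq_iff_abs_eq_abs, hsq]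
    simp
    linear_combination (-(1 / 4 + τ ^ 2)) * hc2 + hτ2 / 4
  · rw [← abs_of_nonneg (norm_nonneg _), ← abs_of_nonneg huv, ← sq_eq_sq_iff_abs_eq_abs, hsq]
    simp
    linear_combination (-(1 / 4 + τ ^ 2)) * hc2 + hτ2 / 4
  · have hq : (starRingEnd ℂ (a + (1 / 2 - τ * Complex.I) * (b - a) - a) * (b - a)).im
        = τ * c ^ 2 := by
      rw [hc2]; simp; ring
    have hq2 : 4 * (τ * c ^ 2) ^ 2 = ((u + v) ^ 2 - c ^ 2) * c ^ 2 := by rw [← hτ2]; ring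
    rw [hq]
    have hduv : 0 < (u - v) ^ 2 := by
      have := sub_ne_zero.2 h
      positivity
    have hgap : 4 * (τ * c ^ 2) ^ 2 - 4 * D ^ 2 = ((u + v) ^ 2 - c ^ 2) * (u - v) ^ 2 := by
      rw [hq2, hheron]; ring
    have hnonneg : 0 ≤ τ * c ^ 2 := by positivity
    refine ⟨?_, fun hpos => ?_⟩
    · have := mul_nonneg hs hduv.le
      exact le_of_abs_le (abs_le_of_sq_le_sq (by linarith) hnonneg)
    · refine lt_of_pow_lt_pow_left₀ 2 hnonneg ?_
      have hs' : 0 < (u + v) ^ 2 - c ^ 2 := by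
        refine lt_of_le_of_ne hs fun h0 => ?_
        rw [← h0, zero_mul] at hheron
        have := pow_pos hpos 2
        linarith
      have := mul_pos hs' hduv
      linarith

lemma ZMod.add_one_ne {n : ℕ} (hn : 3 ≤ n) (k : ZMod n) : k + 1 ≠ k := by
  have : Fact (1 < n) := ⟨by omega⟩
  simp

lemma sum_update {n : ℕ} [NeZero n] (hn : 3 ≤ n) (F : ℂ → ℂ → ℝ) (w : ZMod n → ℂ) (k : ZMod n)
    (q : ℂ) :
    ∑ j, F (Function.update w (k + 1) q j) (Function.update w (k + 1) q (j + 1))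
      = ∑ j, F (w j) (w (j + 1)) + (F (w k) q + F q (w (k + 2))
        - (F (w k) (w (k + 1)) + F (w (k + 1)) (w (k + 2)))) := by
  rw [← sub_eq_iff_eq_add', ← Finset.sum_sub_distrib]
  have h1 := ZMod.add_one_ne hn k
  have h2 := ZMod.add_one_ne hn (k + 1)
  rw [Finset.sum_eq_add k (k + 1) h1.symm]
  · rw [Function.update_self, Function.update_of_ne h1.symm, Function.update_of_ne h2,
      show k + 1 + 1 = k + 2 by ring]
    ring
  · rintro j - ⟨hj1, hj2⟩
    rw [Function.update_of_ne hj2, Function.update_of_ne (fun h => hj1 (add_right_cancel h)),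
      sub_self]
  · simp
  · simp

lemma exists_improvement {n : ℕ} [NeZero n] (hn : 3 ≤ n) (w : ZMod n → ℂ) (k : ZMod n)
    (h : ‖w (k + 1) - w k‖ ≠ ‖w (k + 2) - w (k + 1)‖) :
    ∃ q, sidePow 1 (Function.update w (k + 1) q) = sidePow 1 w ∧
      sidePow 2 (Function.update w (k + 1) q) < sidePow 2 w ∧
      area₂ w ≤ area₂ (Function.update w (k + 1) q) ∧
      (0 < (starRingEnd ℂ (w (k + 1) - w k) * (w (k + 2) - w k)).im →
        area₂ w < area₂ (Function.update w (k + 1) q)) := by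
  obtain ⟨q, hq1, hq2, hle, hlt⟩ := exists_isosceles h
  have e1 := sum_update hn (fun x y => ‖y - x‖ ^ 1) w k q
  have e2 := sum_update hn (fun x y => ‖y - x‖ ^ 2) w k q
  have e3 := sum_update hn (fun x y => (starRingEnd ℂ x * y).im) w k q
  have e4 : ∀ p : ℂ, (starRingEnd ℂ (w k) * p).im + (starRingEnd ℂ p * w (k + 2)).im
      = (starRingEnd ℂ (p - w k) * (w (k + 2) - w k)).im
        + (starRingEnd ℂ (w k) * w (k + 2)).im := fun p => by
    simp; ring
  simp only [e4] at e3
  simp only [hq1, hq2] at e1 e2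
  refine ⟨q, ?_, ?_, ?_, fun hpos => ?_⟩
  · rw [sidePow, e1, sidePow]; ring
  · rw [sidePow, e2, sidePow]
    have := sub_ne_zero.2 h
    have : 0 < (‖w (k + 1) - w k‖ - ‖w (k + 2) - w (k + 1)‖) ^ 2 := by positivity
    nlinarith
  · rw [area₂, area₂, e3]; linarith
  · rw [area₂, area₂, e3]; linarith [hlt hpos]

lemma sidePow_two_of_equilateral {n : ℕ} [NeZero n] {w : ZMod n → ℂ} {l : ℝ}
    (h : ∀ k, ‖w (k + 1) - w k‖ = l) : n * sidePow 2 w = sidePow 1 w ^ 2 := by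
  simp [sidePow, h]; ring

lemma continuous_sidePow {n : ℕ} [NeZero n] (p : ℕ) :
    Continuous (sidePow p : (ZMod n → ℂ) → ℝ) := by
  unfold sidePow; fun_prop

lemma continuous_area₂ {n : ℕ} [NeZero n] : Continuous (area₂ : (ZMod n → ℂ) → ℝ) := by
  unfold area₂; fun_prop

lemma norm_sub_le_sidePow_one {n : ℕ} [NeZero n] (w : ZMod n → ℂ) (k : ZMod n) :
    ‖w (k + 1) - w k‖ ≤ sidePow 1 w := by
  have := Finset.single_le_sum (f := fun k => ‖w (k + 1) - w k‖ ^ 1) (fun _ _ => by positivity)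
    (Finset.mem_univ k)
  simpa [sidePow] using this

lemma isCompact_sidePow_one_le {n : ℕ} [NeZero n] :
    IsCompact {w : ZMod n → ℂ | w 0 = 0 ∧ sidePow 1 w ≤ 1} := by
  refine Metric.isCompact_of_isClosed_isBounded ?_ ?_
  · exact (isClosed_eq (continuous_apply 0) continuous_const).inter
      (isClosed_le (continuous_sidePow 1) continuous_const)
  · refine (Metric.isBounded_closedBall (x := (0 : ZMod n → ℂ)) (r := n)).subset ?_
    rintro w ⟨hw0, hw⟩
    have hm : ∀ m : ℕ, ‖w (m : ZMod n)‖ ≤ m := by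
      intro m
      induction m with
      | zero => simp [hw0]
      | succ m ih =>
        have h1 := (norm_sub_le_sidePow_one w m).trans hw
        have h2 := norm_le_norm_add_norm_sub (w (m : ZMod n)) (w (m + 1))
        push_cast
        rw [norm_sub_rev] at h1
        linarith
    rw [mem_closedBall_zero_iff, pi_norm_le_iff_of_nonneg (by positivity)]
    intro k
    have h1 := hm k.val
    rw [ZMod.natCast_zmod_val] at h1
    have h2 : (k.val : ℝ) ≤ n := by exact_mod_cast k.val_lt.le
    exact h1.trans h2

lemma tan_pi_div_pos {n : ℕ} (hn : 3 ≤ n) : 0 < tan (π / n) := by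
  have h := cos_pi_div_pos hn
  have hn' : (3 : ℝ) ≤ n := by exact_mod_cast hn
  rw [tan_eq_sin_div_cos]
  refine div_pos (sin_pos_of_pos_of_lt_pi (by positivity) ?_) h
  exact div_lt_self pi_pos (by linarith)

/-- If consecutive sides have equal length except possibly at one vertex, all sides are equal. -/
lemma equilateral_of_consecutive {n : ℕ} [NeZero n] {w : ZMod n → ℂ}
    (h : ∀ k : ZMod n, k + 1 ≠ 0 → ‖w (k + 1) - w k‖ = ‖w (k + 2) - w (k + 1)‖) (k : ZMod n) :
    ‖w (k + 1) - w k‖ = ‖w 1 - w 0‖ := by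
  have hm : ∀ m : ℕ, m < n → ‖w ((m : ZMod n) + 1) - w m‖ = ‖w 1 - w 0‖ := by
    intro m
    induction m with
    | zero => simp
    | succ m ih =>
      intro hm
      rw [← ih (by omega), h m]
      · push_cast
        rw [show (m : ZMod n) + 1 + 1 = m + 2 by ring]
      · intro h0
        have : ((m + 1 : ℕ) : ZMod n) = 0 := by exact_mod_cast h0
        rw [ZMod.natCast_eq_zero_iff] at this
        exact absurd (Nat.le_of_dvd (by omega) this) (by omega)
  simpa using hm k.val k.val_lt

lemma area₂_le_of_sidePow_one_le {n : ℕ} [NeZero n] (hn : 3 ≤ n) {w : ZMod n → ℂ} (hw0 : w 0 = 0)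
    (hw : sidePow 1 w ≤ 1) : 2 * n * tan (π / n) * area₂ w ≤ 1 := by
  have hK := isCompact_sidePow_one_le (n := n)
  obtain ⟨w₁, hw₁, hmax⟩ := hK.exists_isMaxOn ⟨w, hw0, hw⟩ continuous_area₂.continuousOn
  obtain ⟨w₂, ⟨hw₂, hw₂'⟩, hmin⟩ := (hK.inter_right
    (isClosed_eq continuous_area₂ (continuous_const (y := area₂ w₁)))).exists_isMinOn
      ⟨w₁, hw₁, rfl⟩ (continuous_sidePow 2).continuousOn
  have hw₂' : area₂ w₂ = area₂ w₁ := hw₂'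
  have heq : ∀ k : ZMod n, k + 1 ≠ 0 → ‖w₂ (k + 1) - w₂ k‖ = ‖w₂ (k + 2) - w₂ (k + 1)‖ := by
    intro k hk
    by_contra hne
    obtain ⟨q, h1, h2, h3, -⟩ := exists_improvement hn w₂ k hne
    have hmem : Function.update w₂ (k + 1) q ∈ {w : ZMod n → ℂ | w 0 = 0 ∧ sidePow 1 w ≤ 1} :=
      ⟨by rw [Function.update_of_ne hk.symm]; exact hw₂.1, by rw [h1]; exact hw₂.2⟩
    have h4 : area₂ (Function.update w₂ (k + 1) q) = area₂ w₁ :=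
      le_antisymm (hmax hmem) (hw₂' ▸ h3)
    exact absurd (hmin ⟨hmem, h4⟩) (not_le.2 h2)
  have h5 := sidePow_two_of_equilateral (equilateral_of_consecutive heq)
  have h6 := area₂_le_sidePow_two hn w₂
  have h7 : area₂ w ≤ area₂ w₂ := hw₂' ▸ hmax ⟨hw0, hw⟩
  have h8 : 0 ≤ sidePow 1 w₂ := Finset.sum_nonneg fun _ _ => by positivity
  have h9 : sidePow 1 w₂ ≤ 1 := hw₂.2
  have ht := tan_pi_div_pos hn
  calc 2 * n * tan (π / n) * area₂ w ≤ 2 * n * tan (π / n) * area₂ w₂ := by gcongr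
    _ = n * (2 * tan (π / n) * area₂ w₂) := by ring
    _ ≤ n * sidePow 2 w₂ := by gcongr
    _ = sidePow 1 w₂ ^ 2 := h5
    _ ≤ 1 := pow_le_one₀ h8 h9

lemma area₂_smul_sub {n : ℕ} [NeZero n] (w : ZMod n → ℂ) (r : ℝ) (c : ℂ) :
    area₂ (fun k => r * (w k - c)) = r ^ 2 * area₂ w := by
  have h : ∀ k, (starRingEnd ℂ (r * (w k - c)) * (r * (w (k + 1) - c))).im
      = r ^ 2 * (starRingEnd ℂ (w k) * w (k + 1)).im
        + (r ^ 2 * (starRingEnd ℂ (w k) * c).im * -1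
          + r ^ 2 * (starRingEnd ℂ (w (k + 1)) * c).im) := by
    intro k
    simp; ring
  have hshift := Equiv.sum_comp (Equiv.addRight (1 : ZMod n))
    fun k => r ^ 2 * (starRingEnd ℂ (w k) * c).im
  simp only [Equiv.coe_addRight] at hshift
  rw [area₂, area₂, Finset.sum_congr rfl fun k _ => h k, Finset.sum_add_distrib,
    Finset.sum_add_distrib, hshift, ← Finset.sum_mul, ← Finset.mul_sum]
  ring

lemma sidePow_one_smul_sub {n : ℕ} [NeZero n] (w : ZMod n → ℂ) {r : ℝ} (hr : 0 ≤ r) (c : ℂ) :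
    sidePow 1 (fun k => r * (w k - c)) = r * sidePow 1 w := by
  rw [sidePow, sidePow, Finset.mul_sum]
  refine Finset.sum_congr rfl fun k _ => ?_
  rw [← mul_sub, sub_sub_sub_cancel_right, norm_mul, Complex.norm_real, Real.norm_of_nonneg hr,
    pow_one, pow_one]

/-- The isoperimetric inequality for closed polygons with `n` vertices. -/
lemma area₂_le_sidePow_one_sq {n : ℕ} [NeZero n] (hn : 3 ≤ n) (w : ZMod n → ℂ) :
    2 * n * tan (π / n) * area₂ w ≤ sidePow 1 w ^ 2 := by
  have h0 : 0 ≤ sidePow 1 w := Finset.sum_nonneg fun _ _ => by positivity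
  rcases h0.eq_or_lt with h0 | h0
  · have hle := area₂_le_sidePow_two hn w
    have h2 : sidePow 2 w = 0 := by
      rw [sidePow]
      refine Finset.sum_eq_zero fun k _ => ?_
      have : ‖w (k + 1) - w k‖ = 0 :=
        le_antisymm (h0 ▸ norm_sub_le_sidePow_one w k) (norm_nonneg _)
      rw [this]; norm_num
    rw [h2] at hle
    rw [← h0]
    have : (0 : ℝ) ≤ n := by positivity
    nlinarith
  · have h1 := area₂_le_of_sidePow_one_le hn (w := fun k => ((sidePow 1 w)⁻¹ : ℝ) * (w k - w 0))
      (by simp) (by rw [sidePow_one_smul_sub _ (by positivity), inv_mul_cancel₀ h0.ne'])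
    rw [area₂_smul_sub, inv_pow, mul_left_comm, inv_mul_le_iff₀ (by positivity), mul_one] at h1
    exact h1

lemma eq_regular_of_area₂_eq_sidePow_one_sq {n : ℕ} [NeZero n] (hn : 3 ≤ n) {w : ZMod n → ℂ}
    (hpos : ∀ k, 0 < (starRingEnd ℂ (w (k + 1) - w k) * (w (k + 2) - w k)).im)
    (h : 2 * n * tan (π / n) * area₂ w = sidePow 1 w ^ 2) :
    ∃ c r : ℂ, ∀ k, w k = c + r * ZMod.stdAddChar k := by
  have hn' : (3 : ℝ) ≤ n := by exact_mod_cast hn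
  have ht := tan_pi_div_pos hn
  have heq : ∀ k : ZMod n, k + 1 ≠ 0 → ‖w (k + 1) - w k‖ = ‖w (k + 2) - w (k + 1)‖ := by
    intro k _
    by_contra hne
    obtain ⟨q, h1, -, -, h4⟩ := exists_improvement hn w k hne
    have h5 := area₂_le_sidePow_one_sq hn (Function.update w (k + 1) q)
    rw [h1, ← h] at h5
    exact absurd (le_of_mul_le_mul_left h5 (by positivity)) (not_le.2 (h4 (hpos k)))
  have h5 := sidePow_two_of_equilateral (equilateral_of_consecutive heq)
  refine eq_regular_of_area₂_eq hn (mul_left_cancel₀ (by positivity : (n : ℝ) ≠ 0) ?_)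
  rw [h5, ← h]; ring

/-- The Euclidean plane identified with `ℂ`. -/
def toComplex (p : Plane) : ℂ := ⟨p 0, p 1⟩

/-- The closed polygon with consecutive vertices `z 0, …, z m`. -/
def cyclicPolygon (m : ℕ) (z : ℕ → Plane) : ZMod (m + 1) → ℂ := fun k => toComplex (z k.val)

lemma norm_toComplex_sub (p q : Plane) : ‖toComplex q - toComplex p‖ = dist p q := by
  rw [dist_comm, EuclideanSpace.dist_eq, Complex.norm_def, Complex.normSq_apply]
  simp [toComplex, Fin.sum_univ_two, Real.dist_eq, sq]

lemma im_conj_mul_eq_cross (a b c : Plane) :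
    (starRingEnd ℂ (toComplex b - toComplex a) * (toComplex c - toComplex a)).im = cross a b c := by
  simp [toComplex, cross]; ring

lemma val_add_one_eq_next {m : ℕ} (k : ZMod (m + 1)) : (k + 1).val = next m k.val := by
  rw [ZMod.val_add, ZMod.val_one_eq_one_mod, Nat.add_mod_mod]
  unfold next
  split_ifs with h
  · rw [h, Nat.mod_self]
  · exact Nat.mod_eq_of_lt (by have := k.val_lt; omega)

lemma sum_zmod_val {m : ℕ} (f : ℕ → ℝ) :
    ∑ k : ZMod (m + 1), f k.val = ∑ k ∈ Finset.range (m + 1), f k :=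
  Fin.sum_univ_eq_sum_range f (m + 1)

lemma sidePow_one_cyclicPolygon (m : ℕ) (z : ℕ → Plane) :
    sidePow 1 (cyclicPolygon m z) = ∑ k ∈ Finset.Iic m, dist (z k) (z (next m k)) := by
  have h : Finset.Iic m = Finset.range (m + 1) := by ext; simp
  rw [h, ← sum_zmod_val (fun k => dist (z k) (z (next m k)))]
  simp only [sidePow, cyclicPolygon, norm_toComplex_sub, val_add_one_eq_next, pow_one]

lemma sum_cross_eq (m : ℕ) (z : ℕ → Plane) :
    ∑ k ∈ Finset.range m, (z k 0 * z (k + 1) 1 - z k 1 * z (k + 1) 0)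
      + (z m 0 * z 0 1 - z m 1 * z 0 0) = ∑ k ∈ Finset.range m, cross (z 0) (z k) (z (k + 1)) := by
  induction m with
  | zero => simp; ring
  | succ m ih =>
    rw [Finset.sum_range_succ, Finset.sum_range_succ, ← ih, cross]; ring

lemma area₂_cyclicPolygon (m : ℕ) (z : ℕ → Plane) :
    area₂ (cyclicPolygon m z) = ∑ k ∈ Finset.range m, cross (z 0) (z k) (z (k + 1)) := by
  have h : ∀ p q : Plane, (starRingEnd ℂ (toComplex p) * toComplex q).im
      = p 0 * q 1 - p 1 * q 0 := fun p q => by simp [toComplex]; ring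
  rw [← sum_cross_eq]
  simp only [area₂, cyclicPolygon, h, val_add_one_eq_next]
  rw [sum_zmod_val (fun k => z k 0 * z (next m k) 1 - z k 1 * z (next m k) 0),
    Finset.sum_range_succ]
  congr 1
  · refine Finset.sum_congr rfl fun k hk => ?_
    rw [next, if_neg (Finset.mem_range.1 hk).ne]
  · simp [next]

lemma IsCCW.area₂_pos {m : ℕ} {z : ℕ → Plane} (h : IsCCW m z) (hm : 2 ≤ m) :
    0 < area₂ (cyclicPolygon m z) := by
  rw [area₂_cyclicPolygon]
  refine Finset.sum_pos' (fun k hk => ?_) ⟨1, Finset.mem_range.2 (by omega),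
    h 0 1 2 (by omega) (by omega) hm⟩
  rcases Nat.eq_zero_or_pos k with rfl | hk0
  · simp
  · exact (h 0 k (k + 1) hk0 (by omega) (Finset.mem_range.1 hk)).le

lemma IsCCW.polygonArea_hull {m : ℕ} {z : ℕ → Plane} (h : IsCCW m z) (hm : 2 ≤ m) :
    polygonArea (hull m z) = area₂ (cyclicPolygon m z) / 2 := by
  have h0 := (h.area₂_pos hm).le
  rw [polygonArea, h.volume_hull hm, ← Finset.sum_div, ← area₂_cyclicPolygon,
    ENNReal.toReal_ofReal (by positivity)]

lemma IsCCW.polygonPerimeter_hull {m : ℕ} {z : ℕ → Plane} (h : IsCCW m z) (hm : 2 ≤ m) :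
    polygonPerimeter (hull m z) = sidePow 1 (cyclicPolygon m z) := by
  rw [polygonPerimeter, h.hausdorffMeasure_frontier hm, sidePow_one_cyclicPolygon,
    ENNReal.toReal_ofReal (Finset.sum_nonneg fun _ _ => dist_nonneg)]

lemma IsCCW.sidePow_one_pos {m : ℕ} {z : ℕ → Plane} (h : IsCCW m z) (hm : 2 ≤ m) :
    0 < sidePow 1 (cyclicPolygon m z) := by
  rw [sidePow_one_cyclicPolygon]
  exact Finset.sum_pos (fun k hk => dist_pos.2 (h.ne_next hm (Finset.mem_Iic.1 hk)))
    ⟨0, by simp⟩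

lemma IsCCW.im_conj_mul_pos {m : ℕ} {z : ℕ → Plane} (h : IsCCW m z) (hm : 2 ≤ m)
    (k : ZMod (m + 1)) :
    0 < (starRingEnd ℂ (cyclicPolygon m z (k + 1) - cyclicPolygon m z k)
      * (cyclicPolygon m z (k + 2) - cyclicPolygon m z k)).im := by
  have hk : k.val ≤ m := Nat.lt_succ_iff.1 k.val_lt
  rw [show k + 2 = k + 1 + 1 by ring]
  simp only [cyclicPolygon, im_conj_mul_eq_cross, val_add_one_eq_next]
  refine h.cross_next_pos hk (next_le (next_le hk)) ?_ ?_ <;> unfold next <;>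
    split_ifs <;> omega

/-- The vertices of a regular `(m + 1)`-gon with centre `c` and circumradius `r`. -/
noncomputable def regularVertex (m : ℕ) (c : Plane) (r θ : ℝ) (k : ℕ) : Plane :=
  c + r • (WithLp.equiv 2 (Fin 2 → ℝ)).symm
    ![cos (θ + 2 * π * k / (m + 1 : ℕ)), sin (θ + 2 * π * k / (m + 1 : ℕ))]

lemma toComplex_regularVertex (m : ℕ) (c : Plane) (r θ : ℝ) (k : ℕ) :
    toComplex (regularVertex m c r θ k) = toComplex c
      + r * Complex.exp (θ * Complex.I)
        * Complex.exp ((2 * π * k / (m + 1 : ℕ) : ℝ) * Complex.I) := by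
  rw [mul_assoc, ← Complex.exp_add, ← add_mul, ← Complex.ofReal_add]
  apply Complex.ext
  · simp [toComplex, regularVertex, Complex.exp_ofReal_mul_I_re, -Complex.ofReal_add]
  · simp [toComplex, regularVertex, Complex.exp_ofReal_mul_I_im, -Complex.ofReal_add]

lemma toComplex_injective : Function.Injective toComplex := by
  intro p q h
  ext i
  fin_cases i
  · exact congrArg Complex.re h
  · exact congrArg Complex.im h

lemma hull_regularVertex (m : ℕ) (c : Plane) (r θ : ℝ) :
    hull m (regularVertex m c r θ) = convexHull ℝ (Set.range fun k : Fin (m + 1) =>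
      c + r • (WithLp.equiv 2 (Fin 2 → ℝ)).symm
        ![cos (θ + 2 * π * k / (m + 1 : ℕ)), sin (θ + 2 * π * k / (m + 1 : ℕ))]) := by
  rw [hull]
  congr 1
  ext x
  constructor
  · rintro ⟨k, hk, rfl⟩
    exact ⟨⟨k, Nat.lt_succ_of_le hk⟩, rfl⟩
  · rintro ⟨k, rfl⟩
    exact ⟨k, Nat.lt_succ_iff.1 k.2, rfl⟩

lemma isRegularNGon_iff {m : ℕ} {P : Set Plane} : IsRegularNGon (m + 1) P ↔
    ∃ c r θ, 0 < r ∧ P = hull m (regularVertex m c r θ) := by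
  simp only [IsRegularNGon, hull_regularVertex]

lemma isRegularNGon_of_cyclicPolygon {m : ℕ} {z : ℕ → Plane} (hz : z 0 ≠ z (next m 0)) {c r : ℂ}
    (h : ∀ k, cyclicPolygon m z k = c + r * ZMod.stdAddChar k) :
    IsRegularNGon (m + 1) (hull m z) := by
  have hr : r ≠ 0 := by
    rintro rfl
    refine hz (toComplex_injective ?_)
    have h0 := h 0
    have h1 := h (0 + 1)
    rw [cyclicPolygon, val_add_one_eq_next] at h1
    rw [cyclicPolygon] at h0
    simp only [ZMod.val_zero, zero_mul] at h0 h1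
    rw [h0, h1]
  refine isRegularNGon_iff.2 ⟨!₂[c.re, c.im], ‖r‖, r.arg, norm_pos_iff.2 hr, ?_⟩
  unfold hull
  refine congrArg _ (Set.image_congr fun k hk => toComplex_injective ?_)
  have hk' : ((k : ℕ) : ZMod (m + 1)).val = k :=
    ZMod.val_cast_of_lt (Nat.lt_succ_of_le hk)
  have := h (k : ℕ)
  rw [cyclicPolygon, stdAddChar_eq, hk'] at this
  rw [this, toComplex_regularVertex, Complex.norm_mul_exp_arg_mul_I,
    show 2 * (π * k / (m + 1 : ℕ)) = 2 * π * k / (m + 1 : ℕ) by ring]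
  rfl

lemma cross_regularVertex (m : ℕ) (c : Plane) (r θ : ℝ) (i j k : ℕ) :
    cross (regularVertex m c r θ i) (regularVertex m c r θ j) (regularVertex m c r θ k)
      = 4 * r ^ 2 * sin (π * (j - i) / (m + 1 : ℕ)) * sin (π * (k - j) / (m + 1 : ℕ))
        * sin (π * (k - i) / (m + 1 : ℕ)) := by
  have key : ∀ α β γ : ℝ, (cos (2 * β) - cos (2 * α)) * (sin (2 * γ) - sin (2 * α))
      - (sin (2 * β) - sin (2 * α)) * (cos (2 * γ) - cos (2 * α))
      = 4 * sin (β - α) * sin (γ - β) * sin (γ - α) := by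
    intro α β γ
    rw [cos_sub_cos, sin_sub_sin, sin_sub_sin, cos_sub_cos,
      show γ - β = (γ + α) - (β + α) - 0 by ring, sub_zero, sin_sub (γ + α) (β + α),
      show (2 * β + 2 * α) / 2 = β + α by ring, show (2 * β - 2 * α) / 2 = β - α by ring,
      show (2 * γ + 2 * α) / 2 = γ + α by ring, show (2 * γ - 2 * α) / 2 = γ - α by ring]
    ring
  have h := key (θ / 2 + π * i / (m + 1 : ℕ)) (θ / 2 + π * j / (m + 1 : ℕ))
    (θ / 2 + π * k / (m + 1 : ℕ))
  have e : ∀ l : ℕ, 2 * (θ / 2 + π * l / (m + 1 : ℕ)) = θ + 2 * π * l / (m + 1 : ℕ) :=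
    fun l => by ring
  have e' : ∀ l l' : ℕ, (θ / 2 + π * l / (m + 1 : ℕ)) - (θ / 2 + π * l' / (m + 1 : ℕ))
      = π * (l - l') / (m + 1 : ℕ) := fun l l' => by ring
  simp only [e, e'] at h
  have := congrArg (fun x => r ^ 2 * x) h
  calc _ = _ := ?_
    _ = _ := this
    _ = _ := by ring
  simp only [cross, regularVertex]
  simp
  ring

lemma isCCW_regularVertex (m : ℕ) (c : Plane) {r : ℝ} (hr : 0 < r) (θ : ℝ) :
    IsCCW m (regularVertex m c r θ) := by
  intro i j k hij hjk hk
  rw [cross_regularVertex]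
  have h : ∀ a b : ℕ, a < b → b ≤ m → 0 < sin (π * (b - a) / (m + 1 : ℕ)) := by
    intro a b hab hb
    have h1 : (0 : ℝ) < b - a := sub_pos.2 (by exact_mod_cast hab)
    refine sin_pos_of_pos_of_lt_pi (by positivity) ?_
    rw [div_lt_iff₀ (by positivity)]
    have h2 : (b : ℝ) ≤ m := by exact_mod_cast hb
    have h3 : (0 : ℝ) ≤ a := by positivity
    exact mul_lt_mul_of_pos_left (by push_cast; linarith) pi_pos
  have h1 := h i j hij (by omega)
  have h2 := h j k hjk (by omega)
  have h3 := h i k (by omega) (by omega)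
  positivity

lemma cyclicPolygon_regularVertex (m : ℕ) (c : Plane) (r θ : ℝ) (k : ZMod (m + 1)) :
    cyclicPolygon m (regularVertex m c r θ) k
      = toComplex c + r * Complex.exp (θ * Complex.I) * ZMod.stdAddChar k := by
  rw [cyclicPolygon, toComplex_regularVertex, stdAddChar_eq, mul_assoc 2 π, mul_div_assoc 2]

lemma equilateral_of_regular {n : ℕ} [NeZero n] {w : ZMod n → ℂ} {c r : ℂ}
    (h : ∀ k, w k = c + r * ZMod.stdAddChar k) (k : ZMod n) :
    ‖w (k + 1) - w k‖ = ‖r‖ * ‖ZMod.stdAddChar (1 : ZMod n) - 1‖ := by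
  rw [h, h, AddChar.map_add_eq_mul, show c + r * (ZMod.stdAddChar k * ZMod.stdAddChar 1)
    - (c + r * ZMod.stdAddChar k) = r * (ZMod.stdAddChar 1 - 1) * ZMod.stdAddChar k by ring,
    norm_mul, norm_mul, AddChar.norm_apply, mul_one]

lemma area₂_eq_of_regular {n : ℕ} [NeZero n] (hn : 3 ≤ n) {w : ZMod n → ℂ} {c r : ℂ}
    (h : ∀ k, w k = c + r * ZMod.stdAddChar k) :
    2 * n * tan (π / n) * area₂ w = sidePow 1 w ^ 2 := by
  have : Fact (1 < n) := ⟨by omega⟩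
  let d : ZMod n → ℂ := fun j => if j = 0 then c else if j = 1 then r else 0
  have hd : ∀ k, w k = ∑ j, d j * ZMod.stdAddChar (j * k) := fun k => by
    rw [Finset.sum_eq_add 0 1 zero_ne_one (fun j _ hj => by simp [d, hj.1, hj.2])
      (by simp) (by simp)]
    simp [d, h]
  have h2 : sidePow 2 w - 2 * tan (π / n) * area₂ w = 0 := by
    rw [sidePow_two_sub_area₂ _ hd, Finset.sum_eq_zero, mul_zero]
    intro j _
    by_cases h0 : j = 0
    · simp [h0]
    by_cases h1 : j = 1
    · rw [h1, eigenvalue_eq (cos_pi_div_pos hn).ne', ZMod.val_one]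
      simp
    · simp [d, h0, h1]
  rw [← sidePow_two_of_equilateral (equilateral_of_regular h)]
  linear_combination (-(n : ℝ)) * h2

/-- The scale-invariant functional `area/perimeter²` is uniquely maximized among convex
`n`-gons by the regular `n`-gons, with maximal value `1/(4 n tan(π/n))`. -/
theorem isoperimetric_ngon (n : ℕ) (hn : 3 ≤ n) (P : Set (EuclideanSpace ℝ (Fin 2)))
    (hP : IsConvexNGon n P) :
    polygonArea P / (polygonPerimeter P) ^ 2 ≤ 1 / (4 * n * Real.tan (π / n)) ∧
      (polygonArea P / (polygonPerimeter P) ^ 2 = 1 / (4 * n * Real.tan (π / n)) ↔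
        IsRegularNGon n P) := by
  obtain ⟨m, rfl⟩ : ∃ m, n = m + 1 := ⟨n - 1, by omega⟩
  have hm : 2 ≤ m := by omega
  obtain ⟨z, hz, rfl⟩ := hP.exists_isCCW
  have ht := tan_pi_div_pos hn
  have hcriterion : ∀ y, IsCCW m y →
      (polygonArea (hull m y) / (polygonPerimeter (hull m y)) ^ 2
        = 1 / (4 * (m + 1 : ℕ) * Real.tan (π / (m + 1 : ℕ))) ↔
      2 * (m + 1 : ℕ) * tan (π / (m + 1 : ℕ)) * area₂ (cyclicPolygon m y)
        = sidePow 1 (cyclicPolygon m y) ^ 2) := by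
    intro y hy
    have hL := hy.sidePow_one_pos hm
    rw [hy.polygonArea_hull hm, hy.polygonPerimeter_hull hm,
      div_eq_div_iff (by positivity) (by positivity)]
    constructor <;> intro h <;> linarith
  refine ⟨?_, fun h => ?_, fun h => ?_⟩
  · have hL := hz.sidePow_one_pos hm
    rw [hz.polygonArea_hull hm, hz.polygonPerimeter_hull hm,
      div_le_div_iff₀ (by positivity) (by positivity)]
    linarith [area₂_le_sidePow_one_sq hn (cyclicPolygon m z)]
  · obtain ⟨c, r, hcr⟩ := eq_regular_of_area₂_eq_sidePow_one_sq hn (hz.im_conj_mul_pos hm)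
      ((hcriterion z hz).1 h)
    exact isRegularNGon_of_cyclicPolygon (hz.ne_next hm (Nat.zero_le m)) hcr
  · obtain ⟨c, r, θ, hr, hP⟩ := isRegularNGon_iff.1 h
    rw [hP]
    exact (hcriterion _ (isCCW_regularVertex m c hr θ)).2
      (area₂_eq_of_regular hn (cyclicPolygon_regularVertex m c r θ))
end

section
/- The sequence n ↦ 1/(4 n tan(π/n)), defined for integers n ≥ 3, is strictly increasing, each of its terms is strictly less than 1/(4π), and it converges to 1/(4π) as n → ∞. -/
open Real Filter

theorem strictConvexOn_tan_Ico : StrictConvexOn ℝ (Set.Ico 0 (π / 2)) tan := by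
  have cos_pos {x : ℝ} (hx : x ∈ Set.Ico 0 (π / 2)) : 0 < cos x :=
    cos_pos_of_mem_Ioo ⟨by linarith [hx.1, pi_pos], hx.2⟩
  refine StrictMonoOn.strictConvexOn_of_deriv (convex_Ico _ _)
    (fun x hx => (continuousAt_tan.2 (cos_pos hx).ne').continuousWithinAt) ?_
  rw [interior_Ico]
  intro x hx y hy hxy
  have hcos : cos y < cos x :=
    cos_lt_cos_of_nonneg_of_le_pi_div_two hx.1.le hy.2.le hxy
  have hy_pos : 0 < cos y := cos_pos ⟨hy.1.le, hy.2⟩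
  simp only [deriv_tan]
  gcongr

theorem mul_tan_lt_mul_tan {x y : ℝ} (hx : 0 < x) (hxy : x < y) (hy : y < π / 2) :
    y * tan x < x * tan y := by
  have h := strictConvexOn_tan_Ico.secant_strict_mono (a := 0) ⟨le_rfl, by linarith⟩
    ⟨hx.le, hxy.trans hy⟩ ⟨(hx.trans hxy).le, hy⟩ hx.ne' (hx.trans hxy).ne' hxy
  simp only [tan_zero, sub_zero] at h
  rw [div_lt_div_iff₀ hx (hx.trans hxy)] at h
  linarith

theorem pi_div_natCast_lt_pi_div_two {n : ℕ} (hn : 3 ≤ n) : π / n < π / 2 := by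
  have : (3 : ℝ) ≤ n := by exact_mod_cast hn
  exact div_lt_div_of_pos_left pi_pos two_pos (by linarith)

theorem tendsto_natCast_mul_tan_pi_div :
    Tendsto (fun n : ℕ => (n : ℝ) * tan (π / n)) atTop (nhds π) := by
  have hd : HasDerivAt tan 1 0 := by simpa using hasDerivAt_tan (x := 0) (by simp)
  have hlim : Tendsto (fun n : ℕ => π / (n : ℝ)) atTop (nhdsWithin 0 {0}ᶜ) := by
    refine tendsto_nhdsWithin_iff.2 ⟨tendsto_const_div_atTop_nhds_zero_nat π, ?_⟩
    filter_upwards [eventually_gt_atTop 0] with n hn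
    have : (0 : ℝ) < n := by exact_mod_cast hn
    exact (div_pos pi_pos this).ne'
  have h := (hd.tendsto_slope_zero.comp hlim).const_mul π
  rw [mul_one] at h
  refine h.congr fun n => ?_
  simp only [Function.comp_apply, zero_add, tan_zero, sub_zero, smul_eq_mul, inv_div]
  field_simp

/-- The sequence `n ↦ 1/(4 n tan(π/n))` (the value of area/perimeter² on a regular `n`-gon),
defined for `n ≥ 3`, is strictly increasing, bounded above strictly by `1/(4π)` (the value
for a disk), and converges to `1/(4π)`. -/
theorem regular_ngon_ratio_strictMono_lt_tendsto :
    StrictMonoOn (fun n : ℕ => 1 / (4 * (n : ℝ) * Real.tan (π / n))) {n : ℕ | 3 ≤ n} ∧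
      (∀ n : ℕ, 3 ≤ n → 1 / (4 * (n : ℝ) * Real.tan (π / n)) < 1 / (4 * π)) ∧
      Tendsto (fun n : ℕ => 1 / (4 * (n : ℝ) * Real.tan (π / n))) atTop (nhds (1 / (4 * π))) := by
  refine ⟨?_, ?_, ?_⟩
  · intro m hm n hn hmn
    simp only [Set.mem_ofPred_eq] at hm hn
    have hm_pos : (0 : ℝ) < m := by exact_mod_cast (by omega : 0 < m)
    have hn_pos : (0 : ℝ) < n := by exact_mod_cast (by omega : 0 < n)
    have hlt : π / n < π / m :=
      div_lt_div_of_pos_left pi_pos hm_pos (by exact_mod_cast hmn)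
    have h := mul_tan_lt_mul_tan (div_pos pi_pos hn_pos) hlt (pi_div_natCast_lt_pi_div_two hm)
    have htan : 0 < tan (π / n) :=
      tan_pos_of_pos_of_lt_pi_div_two (div_pos pi_pos hn_pos) (pi_div_natCast_lt_pi_div_two hn)
    refine one_div_lt_one_div_of_lt (by positivity) ?_
    rw [div_mul_eq_mul_div, div_mul_eq_mul_div, div_lt_div_iff₀ hm_pos hn_pos] at h
    nlinarith [pi_pos]
  · intro n hn
    have hn_pos : (0 : ℝ) < n := by exact_mod_cast (by omega : 0 < n)
    have h := lt_tan (div_pos pi_pos hn_pos) (pi_div_natCast_lt_pi_div_two hn)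
    rw [div_lt_iff₀ hn_pos] at h
    exact one_div_lt_one_div_of_lt (by positivity) (by linarith)
  · simp only [mul_assoc]
    exact tendsto_const_nhds.div (tendsto_natCast_mul_tan_pi_div.const_mul 4) (by positivity)
end

section
/- Let n ≥ 3 be an integer, let c be a real number, and let α : ℤ/nℤ → (0, π) satisfy tan(α(i)/2) + tan(α(i+1)/2) = c for every i ∈ ℤ/nℤ. Then α(i+2) = α(i) for every i ∈ ℤ/nℤ. If moreover n is odd and Σ_{i} α(i) = 2π, then α(i) = 2π/n for every i. -/
open Real

/-- If the interior-angle function `α : ℤ/nℤ → (0, π)` satisfies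
`tan(α i / 2) + tan(α (i+1) / 2) = c` for all `i`, then `α` is `2`-periodic; if moreover
`n` is odd and the angles sum to `2π`, then all angles equal `2π/n`. -/
theorem angles_two_periodic_of_tan_sum_const (n : ℕ) [NeZero n] (hn : 3 ≤ n) (c : ℝ)
    (α : ZMod n → ℝ) (hα : ∀ i, α i ∈ Set.Ioo 0 π)
    (heq : ∀ i : ZMod n, Real.tan (α i / 2) + Real.tan (α (i + 1) / 2) = c) :
    (∀ i : ZMod n, α (i + 2) = α i) ∧
      (Odd n → ∑ i : ZMod n, α i = 2 * π → ∀ i : ZMod n, α i = 2 * π / n) := by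
  have period_two : ∀ i : ZMod n, α (i + 2) = α i := by
    intro i
    have htan : tan (α (i + 2) / 2) = tan (α i / 2) := by
      have h := heq (i + 1)
      rw [add_assoc, one_add_one_eq_two] at h
      linarith [heq i]
    have hmem : ∀ j, α j / 2 ∈ Set.Ioo (-(π / 2)) (π / 2) := fun j =>
      ⟨by linarith [(hα j).1, pi_pos], by linarith [(hα j).2]⟩
    linarith [injOn_tan (hmem (i + 2)) (hmem i) htan]
  refine ⟨period_two, ?_⟩
  rintro ⟨k, hk⟩ hsum i
  have period_even : ∀ (m : ℕ) (j : ZMod n), α (j + m * 2) = α j := fun m j =>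
    Function.Periodic.nat_mul (f := α) period_two m j
  have period_one : Function.Periodic α 1 := by
    intro j
    have hn0 : (2 * k + 1 : ZMod n) = 0 := by
      have h := ZMod.natCast_self n
      rw [congrArg (Nat.cast : ℕ → ZMod n) hk] at h
      exact_mod_cast h
    have hj : j + 1 = j + ((k + 1 : ℕ) : ZMod n) * 2 := by
      push_cast
      linear_combination -hn0
    rw [hj, period_even]
  have hconst : ∀ j, α j = α i := by
    have hzero : ∀ j, α j = α 0 := fun j => by
      simpa using period_one.nat_mul j.val 0
    exact fun j => (hzero j).trans (hzero i).symm
  have hnpos : (n : ℝ) ≠ 0 := Nat.cast_ne_zero.mpr (NeZero.ne n)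
  rw [Finset.sum_congr rfl fun j _ => hconst j] at hsum
  rw [eq_div_iff hnpos, ← hsum]
  simp [ZMod.card, mul_comm]
end

section
/- Let L ≥ W > 0 and L' ≥ W' > 0 be real numbers and let α, α' ∈ (0, π/2]. If the two parallelograms with side lengths (L, W) and smallest interior angle α, respectively (L', W') and smallest interior angle α', have the same perimeter (i.e., L + W = L' + W'), the same area (i.e., L·W·sin α = L'·W'·sin α'), and the same corner invariant (i.e., 2·(π² − α²)/(24πα) + 2·(π² − (π−α)²)/(24π(π−α)) = 2·(π² − α'²)/(24πα') + 2·(π² − (π−α')²)/(24π(π−α'))), then L = L', W = W', and α = α'. In particular, two parallelograms with the same perimeter, area, and heat-trace corner invariant are congruent. -/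
open Real

/-- The corner invariant of a parallelogram is an affine function of `1 / (α (π - α))`. -/
theorem parallelogram_corner_invariant_eq {α : ℝ} (h₀ : α ≠ 0) (h₁ : π - α ≠ 0) :
    2 * (π ^ 2 - α ^ 2) / (24 * π * α) +
        2 * (π ^ 2 - (π - α) ^ 2) / (24 * π * (π - α)) =
      (π ^ 2 / (α * (π - α)) - 1) / 12 := by
  have hπ := pi_ne_zero
  field_simp
  ring

/-- Two pairs of reals `y ≤ x` with the same sum and the same product coincide. -/
theorem eq_and_eq_of_add_eq_of_mul_eq {x y x' y' : ℝ} (h : y ≤ x) (h' : y' ≤ x')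
    (hadd : x + y = x' + y') (hmul : x * y = x' * y') : x = x' ∧ y = y' := by
  have key : (x - x') * (x - y') = 0 := by linear_combination x * hadd - hmul
  rcases mul_eq_zero.mp key with h0 | h0 <;> constructor <;> linarith

/-- One can hear the shape of a parallelogram: two parallelograms (with side lengths
`L ≥ W > 0`, resp. `L' ≥ W' > 0`, and smallest interior angles `α, α' ∈ (0, π/2]`) having
the same perimeter, the same area, and the same heat-trace corner invariant are congruent. -/
theorem hear_parallelogram (L W L' W' α α' : ℝ)
    (hW : 0 < W) (hWL : W ≤ L) (hW' : 0 < W') (hWL' : W' ≤ L')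
    (hα : α ∈ Set.Ioc 0 (π / 2)) (hα' : α' ∈ Set.Ioc 0 (π / 2))
    (hper : L + W = L' + W')
    (harea : L * W * Real.sin α = L' * W' * Real.sin α')
    (hcorner :
      2 * (π ^ 2 - α ^ 2) / (24 * π * α) +
          2 * (π ^ 2 - (π - α) ^ 2) / (24 * π * (π - α)) =
        2 * (π ^ 2 - α' ^ 2) / (24 * π * α') +
          2 * (π ^ 2 - (π - α') ^ 2) / (24 * π * (π - α'))) :
    L = L' ∧ W = W' ∧ α = α' := by
  obtain ⟨h₀, h₁⟩ := hα
  obtain ⟨h₀', h₁'⟩ := hα'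
  have hπ := pi_pos
  have hp : 0 < π - α := by linarith
  have hp' : 0 < π - α' := by linarith
  rw [parallelogram_corner_invariant_eq h₀.ne' hp.ne',
    parallelogram_corner_invariant_eq h₀'.ne' hp'.ne'] at hcorner
  have hdiv : π ^ 2 / (α * (π - α)) = π ^ 2 / (α' * (π - α')) := by linarith
  have hprod : (π - α) * α = (π - α') * α' := by
    rw [div_eq_div_iff (mul_pos h₀ hp).ne' (mul_pos h₀' hp').ne'] at hdiv
    have := mul_left_cancel₀ (pow_pos hπ 2).ne' hdiv
    linarith
  have hang : α = α' :=
    (eq_and_eq_of_add_eq_of_mul_eq (by linarith) (by linarith) (by ring) hprod).2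
  subst hang
  have hsin : sin α ≠ 0 := (sin_pos_of_pos_of_lt_pi h₀ (by linarith)).ne'
  obtain ⟨hL, hW⟩ := eq_and_eq_of_add_eq_of_mul_eq hWL hWL' hper (mul_right_cancel₀ hsin harea)
  exact ⟨hL, hW, rfl⟩
end

section
/- Let p and q be real numbers. Then the system of equations csc(α) + csc(β) = p and 1/(α(π−α)) + 1/(β(π−β)) = q has at most one solution (α, β) with 0 < β ≤ α ≤ π/2. That is, if (α, β) and (α', β') both satisfy 0 < β ≤ α ≤ π/2, 0 < β' ≤ α' ≤ π/2, csc(α)+csc(β) = csc(α')+csc(β'), and 1/(α(π−α)) + 1/(β(π−β)) = 1/(α'(π−α')) + 1/(β'(π−β')), then α = α' and β = β'. -/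
open Real

open Filter Topology in
/-- Real form of the Mittag-Leffler expansion of the cotangent on `(0, 1)`. -/
lemma tendsto_sum_cot_pi_mul {x : ℝ} (h0 : 0 < x) (h1 : x < 1) :
    Tendsto (fun n : ℕ => ∑ j ∈ Finset.range n, (1 / (x - (j + 1)) + 1 / (x + (j + 1))))
      atTop (𝓝 (π * Real.cot (π * x) - 1 / x)) := by
  have hx : (x : ℂ) ∈ Complex.integerComplement := by
    rw [Complex.mem_integerComplement_iff]
    rintro ⟨n, hn⟩
    have hn' : (n : ℝ) = x := by exact_mod_cast hn
    rw [← hn'] at h0 h1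
    have : 0 < n := by exact_mod_cast h0
    have : n < 1 := by exact_mod_cast h1
    omega
  have h := (Complex.continuous_re.tendsto _).comp (tendsto_logDeriv_euler_cot_sub hx)
  have hlim : ((π : ℂ) * Complex.cot (π * x) - 1 / x).re = π * Real.cot (π * x) - 1 / x := by
    rw [← Complex.ofReal_re (π * Real.cot (π * x) - 1 / x)]
    push_cast
    rfl
  rw [hlim] at h
  refine h.congr fun n => ?_
  rw [← Complex.ofReal_re (∑ j ∈ Finset.range n, _)]
  push_cast
  rfl

/-- A lower bound for the cotangent on `(0, π / 2)`, sharp at both ends. -/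
lemma cot_pi_mul_lower_bound {z : ℝ} (h0 : 0 < z) (h1 : z < 1 / 2) :
    1 / z - 2 * z / (1 - z ^ 2) - 4 * z / 3 ≤ π * Real.cot (π * z) := by
  have partial_sum (n : ℕ) :
      -(2 * z / (1 - z ^ 2)) - 2 * z * (2 / 3 - 1 / (n + 3 / 2)) ≤
        ∑ j ∈ Finset.range (n + 1), (1 / (z - (j + 1)) + 1 / (z + (j + 1))) := by
    induction n with
    | zero =>
      have : z - 1 ≠ 0 := by linarith
      have : z + 1 ≠ 0 := by linarith
      have : 1 - z ^ 2 ≠ 0 := by nlinarith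
      apply le_of_eq
      simp
      field_simp
      ring
    | succ n ih =>
      rw [Finset.sum_range_succ]
      push_cast
      have hn : (0 : ℝ) ≤ n := n.cast_nonneg
      have ha : z - (n + 1 + 1) ≠ 0 := by linarith
      have hb : z + (n + 1 + 1) ≠ 0 := by linarith
      have hpos : (0 : ℝ) < (n + 2) ^ 2 - 1 / 4 := by nlinarith
      have hc : (0 : ℝ) < (n + 2) ^ 2 - z ^ 2 := by nlinarith
      have hterm : 1 / (z - (n + 1 + 1)) + 1 / (z + (n + 1 + 1)) =
          -(2 * z * (1 / ((n + 2) ^ 2 - z ^ 2))) := by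
        field_simp
        ring
      have htel : 1 / ((n : ℝ) + 3 / 2) - 1 / (n + 1 + 3 / 2) = 1 / ((n + 2) ^ 2 - 1 / 4) := by
        have : ((n : ℝ) + 2) ^ 2 - 1 / 4 = (n + 3 / 2) * (n + 1 + 3 / 2) := by ring
        rw [this]
        field_simp
        ring
      have hle : 1 / (((n : ℝ) + 2) ^ 2 - z ^ 2) ≤ 1 / ((n + 2) ^ 2 - 1 / 4) :=
        one_div_le_one_div_of_le hpos (by nlinarith)
      rw [← htel] at hle
      rw [hterm]
      have := mul_le_mul_of_nonneg_left hle (by linarith : 0 ≤ 2 * z)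
      linarith
  have hlim := (Filter.tendsto_add_atTop_iff_nat 1).2
    (tendsto_sum_cot_pi_mul h0 (by linarith))
  have := ge_of_tendsto' (b := -(2 * z / (1 - z ^ 2)) - 4 * z / 3) hlim fun n => by
    have : 0 ≤ 2 * z * (1 / ((n : ℝ) + 3 / 2)) := by positivity
    linarith [partial_sum n]
  linarith

/-- A lower bound for the cotangent on `(0, π / 2)` that includes the pole at `π`. -/
lemma cot_pi_mul_lower_bound_two_poles {x : ℝ} (h0 : 0 < x) (h1 : x < 1 / 2) :
    1 / x - 1 / (1 - x) + (1 / 2 - x) * (2 - x * (1 - x)) ≤ π * Real.cot (π * x) := by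
  set c := (1 / 2 - x) * (2 - x * (1 - x)) with hc
  have partial_sum (n : ℕ) :
      -(1 / (1 - x)) + c * (1 - 1 / (n + 1)) + 1 / (n + 1 + x) ≤
        ∑ j ∈ Finset.range (n + 1), (1 / (x - (j + 1)) + 1 / (x + (j + 1))) := by
    induction n with
    | zero =>
      have : x - 1 ≠ 0 := by linarith
      have : 1 - x ≠ 0 := by linarith
      have : x + 1 ≠ 0 := by linarith
      apply le_of_eq
      simp
      field_simp
      ring
    | succ n ih =>
      rw [Finset.sum_range_succ]
      push_cast
      have hn : (0 : ℝ) ≤ n := n.cast_nonneg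
      have ha : x - (n + 1 + 1) = -(n + 2 - x) := by ring
      have hd : (0 : ℝ) < n + 2 - x := by linarith
      have hpair : c * (1 / ((n : ℝ) + 1) - 1 / (n + 1 + 1)) ≤
          1 / (n + 1 + x) - 1 / (n + 2 - x) := by
        have e1 : c * (1 / ((n : ℝ) + 1) - 1 / (n + 1 + 1)) = c / ((n + 1) * (n + 2)) := by
          field_simp
          ring
        have e2 : 1 / ((n : ℝ) + 1 + x) - 1 / (n + 2 - x) =
            (1 - 2 * x) / ((n + 1 + x) * (n + 2 - x)) := by
          field_simp
          ring
        have hxx : 0 ≤ x * (1 - x) := mul_nonneg h0.le (by linarith)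
        have key : (2 - x * (1 - x)) * ((n + 1 + x) * (n + 2 - x)) ≤
            2 * (((n : ℝ) + 1) * (n + 2)) := by
          have : 0 ≤ x * (1 - x) * ((n : ℝ) ^ 2 + 3 * n + x * (1 - x)) := by positivity
          nlinarith
        rw [e1, e2, div_le_div_iff₀ (by positivity) (by positivity), hc]
        have := mul_le_mul_of_nonneg_left key (by linarith : 0 ≤ 1 / 2 - x)
        linarith
      rw [ha, one_div_neg_eq_neg_one_div, add_comm x]
      linarith
  have hlim := (Filter.tendsto_add_atTop_iff_nat 1).2
    (tendsto_sum_cot_pi_mul h0 (by linarith))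
  have hbound : Filter.Tendsto (fun n : ℕ => -(1 / (1 - x)) + c * (1 - 1 / ((n : ℝ) + 1)))
      Filter.atTop (nhds (-(1 / (1 - x)) + c * (1 - 0))) :=
    ((tendsto_one_div_add_atTop_nhds_zero_nat.const_sub 1).const_mul c).const_add _
  have := le_of_tendsto_of_tendsto' hbound hlim fun n => by
    have : 0 ≤ 1 / ((n : ℝ) + 1 + x) := by positivity
    linarith [partial_sum n]
  linarith

lemma rational_lt_tan_add_two_mul_cot {x : ℝ} (h0 : 0 < x) (h1 : x < π / 2) :
    2 / x - 2 / (π - x) + 2 / (π - 2 * x) <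
      Real.sin x / Real.cos x + 2 * (Real.cos x / Real.sin x) := by
  have hπ := Real.pi_pos
  obtain ⟨y, rfl⟩ : ∃ y, x = π * y := ⟨x / π, by field_simp⟩
  have hy0 : 0 < y := pos_of_mul_pos_right h0 hπ.le
  have hy1 : y < 1 / 2 := by
    by_contra! h
    nlinarith
  have hA := cot_pi_mul_lower_bound (z := 1 / 2 - y) (by linarith) (by linarith)
  have hB := cot_pi_mul_lower_bound_two_poles hy0 hy1
  rw [show π * (1 / 2 - y) = π / 2 - π * y by ring, Real.cot_eq_cos_div_sin,
    Real.cos_pi_div_two_sub, Real.sin_pi_div_two_sub] at hA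
  rw [Real.cot_eq_cos_div_sin] at hB
  have hgap : 2 * (1 / 2 - y) / (1 - (1 / 2 - y) ^ 2) + 4 * (1 / 2 - y) / 3 <
      2 * ((1 / 2 - y) * (2 - y * (1 - y))) := by
    have hden : 0 < 1 - (1 / 2 - y) ^ 2 := by nlinarith
    have hz : 0 < 1 / 2 - y := by linarith
    have ha : 0 < y * (1 - y) := mul_pos hy0 (by linarith)
    rw [← lt_sub_iff_add_lt, div_lt_iff₀ hden, ← sub_pos]
    have : 0 < (1 / 2 - y) * (y * (1 - y)) * (7 / 6 - 2 * (y * (1 - y))) :=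
      mul_pos (mul_pos hz ha) (by nlinarith)
    exact this.trans_eq (by ring)
  have hscale : π * (2 / (π * y) - 2 / (π - π * y) + 2 / (π - 2 * (π * y))) =
      2 * (1 / y - 1 / (1 - y)) + 1 / (1 / 2 - y) := by
    have : 1 - y ≠ 0 := by linarith
    have : 1 - 2 * y ≠ 0 := by linarith
    rw [show π - π * y = π * (1 - y) by ring, show π - 2 * (π * y) = π * (1 - 2 * y) by ring,
      show 1 / 2 - y = (1 - 2 * y) / 2 by ring]
    field_simp
  refine lt_of_mul_lt_mul_left ?_ hπ.le
  rw [hscale]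
  linarith

/-- The quotient of the derivatives of `csc` and of `x ↦ 1 / (x * (π - x))` is strictly decreasing
on `(0, π / 2)`; this is its logarithm. -/
lemma strictAntiOn_log_deriv_ratio :
    StrictAntiOn (fun x : ℝ => Real.log (Real.cos x) + 2 * Real.log x + 2 * Real.log (π - x)
      - 2 * Real.log (Real.sin x) - Real.log (π - 2 * x)) (Set.Ioo 0 (π / 2)) := by
  have hderiv (x : ℝ) (hx : x ∈ Set.Ioo 0 (π / 2)) :
      HasDerivAt (fun x : ℝ => Real.log (Real.cos x) + 2 * Real.log x + 2 * Real.log (π - x)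
        - 2 * Real.log (Real.sin x) - Real.log (π - 2 * x))
        (-Real.sin x / Real.cos x + 2 * x⁻¹ + 2 * (-1 / (π - x))
          - 2 * (Real.cos x / Real.sin x) - (-(2 * 1)) / (π - 2 * x)) x := by
    obtain ⟨h0, h1⟩ := hx
    have hcos : Real.cos x ≠ 0 := (Real.cos_pos_of_mem_Ioo ⟨by linarith, h1⟩).ne'
    have hsin : Real.sin x ≠ 0 := (Real.sin_pos_of_pos_of_lt_pi h0 (by linarith)).ne'
    exact ((((((Real.hasDerivAt_cos x).log hcos).add
      ((Real.hasDerivAt_log h0.ne').const_mul 2)).add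
      ((((hasDerivAt_id x).const_sub π).log (by simp; linarith)).const_mul 2)).sub
      (((Real.hasDerivAt_sin x).log hsin).const_mul 2)).sub
      ((((hasDerivAt_id x).const_mul 2).const_sub π).log (by simp; linarith)))
  refine strictAntiOn_of_deriv_neg (convex_Ioo _ _)
    (fun x hx => (hderiv x hx).continuousAt.continuousWithinAt) fun x hx => ?_
  rw [interior_Ioo] at hx
  rw [(hderiv x hx).deriv]
  have := rational_lt_tan_add_two_mul_cot hx.1 hx.2
  simp only [neg_div, mul_one, mul_neg, mul_one_div, ← div_eq_mul_inv]
  linarith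

lemma hasDerivAt_one_div_sin {x : ℝ} (h0 : 0 < x) (h1 : x < π) :
    HasDerivAt (fun x => 1 / Real.sin x) (-Real.cos x / Real.sin x ^ 2) x := by
  simpa only [one_div] using
    (Real.hasDerivAt_sin x).fun_inv (Real.sin_pos_of_pos_of_lt_pi h0 h1).ne'

lemma hasDerivAt_one_div_mul_pi_sub {x : ℝ} (h0 : 0 < x) (h1 : x < π) :
    HasDerivAt (fun x => 1 / (x * (π - x))) (-(π - 2 * x) / (x * (π - x)) ^ 2) x := by
  have h : HasDerivAt (fun x : ℝ => x * (π - x)) (π - 2 * x) x :=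
    ((hasDerivAt_id' x).fun_mul ((hasDerivAt_id' x).const_sub π)).congr_deriv (by ring)
  simpa only [one_div] using h.fun_inv (mul_pos h0 (sub_pos.2 h1)).ne'

lemma deriv_cross_mul_ne {c d : ℝ} (hc : 0 < c) (hcd : c < d) (hd : d < π / 2) :
    (-Real.cos c / Real.sin c ^ 2) * (-(π - 2 * d) / (d * (π - d)) ^ 2) ≠
      (-Real.cos d / Real.sin d ^ 2) * (-(π - 2 * c) / (c * (π - c)) ^ 2) := by
  intro h
  have log_eq (x y : ℝ) (hx : x ∈ Set.Ioo 0 (π / 2)) (hy : y ∈ Set.Ioo 0 (π / 2)) :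
      Real.log ((-Real.cos x / Real.sin x ^ 2) * (-(π - 2 * y) / (y * (π - y)) ^ 2)) =
        Real.log (Real.cos x) - 2 * Real.log (Real.sin x) + Real.log (π - 2 * y)
          - 2 * (Real.log y + Real.log (π - y)) := by
    have hcos : Real.cos x ≠ 0 := (Real.cos_pos_of_mem_Ioo ⟨by linarith [hx.1], hx.2⟩).ne'
    have hsin : Real.sin x ≠ 0 :=
      (Real.sin_pos_of_pos_of_lt_pi hx.1 (by linarith [hx.1, hx.2])).ne'
    have h1 : y ≠ 0 := hy.1.ne'
    have h2 : π - y ≠ 0 := by linarith [hy.1, hy.2]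
    have h3 : π - 2 * y ≠ 0 := by linarith [hy.2]
    rw [neg_div, neg_div, neg_mul_neg, Real.log_mul (by positivity) (by positivity),
      Real.log_div hcos (by positivity), Real.log_div h3 (by positivity), Real.log_pow,
      Real.log_pow, Real.log_mul h1 h2]
    push_cast
    ring
  have hc' : c ∈ Set.Ioo 0 (π / 2) := ⟨hc, hcd.trans hd⟩
  have hd' : d ∈ Set.Ioo 0 (π / 2) := ⟨hc.trans hcd, hd⟩
  have hlog := congrArg Real.log h
  rw [log_eq c d hc' hd', log_eq d c hd' hc'] at hlog
  have := strictAntiOn_log_deriv_ratio hc' hd' hcd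
  simp only at this
  linarith

lemma exists_deriv_ratio_csc {a b : ℝ} (ha : 0 < a) (hab : a < b) (hb : b ≤ π / 2) :
    ∃ c ∈ Set.Ioo a b,
      (1 / (b * (π - b)) - 1 / (a * (π - a))) * (-Real.cos c / Real.sin c ^ 2) =
        (1 / Real.sin b - 1 / Real.sin a) * (-(π - 2 * c) / (c * (π - c)) ^ 2) := by
  have hπ := Real.pi_pos
  refine exists_ratio_hasDerivAt_eq_ratio_slope (fun x => 1 / Real.sin x)
    (fun x => -Real.cos x / Real.sin x ^ 2) hab ?_ ?_
    (fun x => 1 / (x * (π - x))) (fun x => -(π - 2 * x) / (x * (π - x)) ^ 2) ?_ ?_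
  · exact fun x hx => (hasDerivAt_one_div_sin (by linarith [hx.1])
      (by linarith [hx.2])).continuousAt.continuousWithinAt
  · exact fun x hx => hasDerivAt_one_div_sin (by linarith [hx.1]) (by linarith [hx.2])
  · exact fun x hx => (hasDerivAt_one_div_mul_pi_sub (by linarith [hx.1])
      (by linarith [hx.2])).continuousAt.continuousWithinAt
  · exact fun x hx => hasDerivAt_one_div_mul_pi_sub (by linarith [hx.1]) (by linarith [hx.2])

lemma strictAntiOn_one_div_sin :
    StrictAntiOn (fun x => 1 / Real.sin x) (Set.Ioc 0 (π / 2)) := fun x hx y hy hxy =>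
  one_div_lt_one_div_of_lt (Real.sin_pos_of_pos_of_lt_pi hx.1 (by linarith [hx.1, hx.2]))
    (Real.sin_lt_sin_of_lt_of_le_pi_div_two (by linarith [hx.1, hx.2]) hy.2 hxy)

lemma not_lt_of_csc_add_eq {α β α' β' : ℝ}
    (hβ : 0 < β) (hβα : β ≤ α) (hα : α ≤ π / 2) (hβα' : β' ≤ α') (hα' : α' ≤ π / 2)
    (h1 : 1 / Real.sin α + 1 / Real.sin β = 1 / Real.sin α' + 1 / Real.sin β')
    (h2 : 1 / (α * (π - α)) + 1 / (β * (π - β)) =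
        1 / (α' * (π - α')) + 1 / (β' * (π - β'))) :
    ¬β < β' := by
  intro hlt
  have hmem {x : ℝ} (h0 : β ≤ x) (h : x ≤ π / 2) : x ∈ Set.Ioc 0 (π / 2) :=
    ⟨hβ.trans_le h0, h⟩
  have hαα' : α' < α := by
    rw [← strictAntiOn_one_div_sin.lt_iff_gt (hmem hβα hα) (hmem (hlt.le.trans hβα') hα')]
    have := strictAntiOn_one_div_sin (hmem le_rfl (hβα.trans hα))
      (hmem hlt.le (hβα'.trans hα')) hlt
    simp only at this ⊢
    linarith
  obtain ⟨c, hc, hceq⟩ := exists_deriv_ratio_csc hβ hlt (hβα'.trans hα')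
  obtain ⟨d, hd, hdeq⟩ := exists_deriv_ratio_csc (hβ.trans (hlt.trans_le hβα')) hαα' hα
  rw [show 1 / (α * (π - α)) - 1 / (α' * (π - α')) =
      1 / (β' * (π - β')) - 1 / (β * (π - β)) by linarith,
    show 1 / Real.sin α - 1 / Real.sin α' = 1 / Real.sin β' - 1 / Real.sin β by linarith] at hdeq
  have hne : 1 / (β' * (π - β')) - 1 / (β * (π - β)) ≠ 0 := by
    refine (sub_neg.2 (one_div_lt_one_div_of_lt (mul_pos hβ (by linarith)) ?_)).ne
    nlinarith
  refine deriv_cross_mul_ne (hβ.trans hc.1) (by linarith [hc.2, hd.1]) (hd.2.trans_le hα)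
    (mul_left_cancel₀ hne ?_)
  rw [← mul_assoc, ← mul_assoc, hceq, hdeq]
  ring

/-- For any real numbers `p, q`, the system `csc α + csc β = p`,
`1/(α(π−α)) + 1/(β(π−β)) = q` has at most one solution with `0 < β ≤ α ≤ π/2`. -/
theorem trapezoid_angle_system_unique (α β α' β' : ℝ)
    (hβ : 0 < β) (hβα : β ≤ α) (hα : α ≤ π / 2)
    (hβ' : 0 < β') (hβα' : β' ≤ α') (hα' : α' ≤ π / 2)
    (h1 : 1 / Real.sin α + 1 / Real.sin β = 1 / Real.sin α' + 1 / Real.sin β')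
    (h2 : 1 / (α * (π - α)) + 1 / (β * (π - β)) =
        1 / (α' * (π - α')) + 1 / (β' * (π - β'))) :
    α = α' ∧ β = β' := by
  have hββ' : β = β' := le_antisymm
    (not_lt.1 (not_lt_of_csc_add_eq hβ' hβα' hα' hβα hα h1.symm h2.symm))
    (not_lt.1 (not_lt_of_csc_add_eq hβ hβα hα hβα' hα' h1 h2))
  refine ⟨strictAntiOn_one_div_sin.injOn ⟨hβ.trans_le hβα, hα⟩ ⟨hβ'.trans_le hβα', hα'⟩ ?_, hββ'⟩
  subst hββ'
  exact add_right_cancel h1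
end

section
/- Let b, h > 0, b', h' > 0, and let α, β, α', β' ∈ (0, π/2) with β ≤ α, β' ≤ α', α + β < π/2, and α' + β' < π/2. Consider the acute trapezoids with top side b (resp. b'), height h (resp. h'), base angles α, β (resp. α', β'), base B = b + h cot α + h cot β (resp. B' = b' + h' cot α' + h' cot β'), and legs h csc α, h csc β (resp. h' csc α', h' csc β'). If the two trapezoids have the same height (h = h'), the same area ((B+b)h/2 = (B'+b')h'/2), the same perimeter (B + b + h csc α + h csc β = B' + b' + h' csc α' + h' csc β'), and the same corner invariant (Σ over the four interior angles {α, β, π−α, π−β} of (π² − γ²)/(24πγ) equals the corresponding sum for {α', β', π−α', π−β'}), then b = b', h = h', α = α', and β = β'. In particular, two acute trapezoids with the same area, perimeter, height, and heat-trace corner invariant are congruent. -/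
open Real

theorem Real.sub_cube_div_six_le_sin {x : ℝ} (hx : 0 ≤ x) : x - x ^ 3 / 6 ≤ sin x := by
  have hd (y : ℝ) : HasDerivAt (fun y ↦ sin y - (y - y ^ 3 / 6)) (cos y - (1 - y ^ 2 / 2)) y := by
    have h := (hasDerivAt_sin y).sub ((hasDerivAt_id' y).sub ((hasDerivAt_pow 3 y).div_const 6))
    refine h.congr_deriv ?_
    push_cast
    ring
  have hm : MonotoneOn (fun y ↦ sin y - (y - y ^ 3 / 6)) (Set.Ici 0) :=
    monotoneOn_of_hasDerivWithinAt_nonneg (convex_Ici 0)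
      (fun y _ ↦ (hd y).continuousAt.continuousWithinAt)
      (fun y _ ↦ (hd y).hasDerivWithinAt)
      (fun y _ ↦ by linarith [one_sub_sq_div_two_le_cos (x := y)])
  have := hm Set.self_mem_Ici hx hx
  simp only [sin_zero] at this
  linarith

theorem Real.cos_le_taylor_four {x : ℝ} (hx : 0 ≤ x) :
    cos x ≤ 1 - x ^ 2 / 2 + x ^ 4 / 24 := by
  have hd (y : ℝ) : HasDerivAt (fun y ↦ 1 - y ^ 2 / 2 + y ^ 4 / 24 - cos y)
      (sin y - (y - y ^ 3 / 6)) y := by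
    have h := ((((hasDerivAt_pow 2 y).div_const 2).const_sub 1).add
      ((hasDerivAt_pow 4 y).div_const 24)).sub (hasDerivAt_cos y)
    refine h.congr_deriv ?_
    push_cast
    ring
  have hm : MonotoneOn (fun y ↦ 1 - y ^ 2 / 2 + y ^ 4 / 24 - cos y) (Set.Ici 0) :=
    monotoneOn_of_hasDerivWithinAt_nonneg (convex_Ici 0)
      (fun y _ ↦ (hd y).continuousAt.continuousWithinAt)
      (fun y _ ↦ (hd y).hasDerivWithinAt)
      (fun y hy ↦ sub_nonneg.2 (sub_cube_div_six_le_sin (interior_subset hy)))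
  have := hm Set.self_mem_Ici hx hx
  simp only [cos_zero] at this
  linarith

theorem Real.sin_le_taylor_five {x : ℝ} (hx : 0 ≤ x) :
    sin x ≤ x - x ^ 3 / 6 + x ^ 5 / 120 := by
  have hd (y : ℝ) : HasDerivAt (fun y ↦ y - y ^ 3 / 6 + y ^ 5 / 120 - sin y)
      (1 - y ^ 2 / 2 + y ^ 4 / 24 - cos y) y := by
    have h := (((hasDerivAt_id' y).sub ((hasDerivAt_pow 3 y).div_const 6)).add
      ((hasDerivAt_pow 5 y).div_const 120)).sub (hasDerivAt_sin y)
    refine h.congr_deriv ?_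
    push_cast
    ring
  have hm : MonotoneOn (fun y ↦ y - y ^ 3 / 6 + y ^ 5 / 120 - sin y) (Set.Ici 0) :=
    monotoneOn_of_hasDerivWithinAt_nonneg (convex_Ici 0)
      (fun y _ ↦ (hd y).continuousAt.continuousWithinAt)
      (fun y _ ↦ (hd y).hasDerivWithinAt)
      (fun y hy ↦ sub_nonneg.2 (cos_le_taylor_four (interior_subset hy)))
  have := hm Set.self_mem_Ici hx hx
  simp only [sin_zero] at this
  linarith

theorem Real.taylor_six_le_cos {x : ℝ} (hx : 0 ≤ x) :
    1 - x ^ 2 / 2 + x ^ 4 / 24 - x ^ 6 / 720 ≤ cos x := by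
  have hd (y : ℝ) : HasDerivAt (fun y ↦ cos y - (1 - y ^ 2 / 2 + y ^ 4 / 24 - y ^ 6 / 720))
      (y - y ^ 3 / 6 + y ^ 5 / 120 - sin y) y := by
    have h := (hasDerivAt_cos y).sub (((((hasDerivAt_pow 2 y).div_const 2).const_sub 1).add
      ((hasDerivAt_pow 4 y).div_const 24)).sub ((hasDerivAt_pow 6 y).div_const 720))
    refine h.congr_deriv ?_
    push_cast
    ring
  have hm : MonotoneOn (fun y ↦ cos y - (1 - y ^ 2 / 2 + y ^ 4 / 24 - y ^ 6 / 720))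
      (Set.Ici 0) :=
    monotoneOn_of_hasDerivWithinAt_nonneg (convex_Ici 0)
      (fun y _ ↦ (hd y).continuousAt.continuousWithinAt)
      (fun y _ ↦ (hd y).hasDerivWithinAt)
      (fun y hy ↦ sub_nonneg.2 (sin_le_taylor_five (interior_subset hy)))
  have := hm Set.self_mem_Ici hx hx
  simp only [cos_zero] at this
  linarith

theorem sin_mul_lt_of_le {θ : ℝ} (h0 : 0 < θ) (h1 : θ ≤ 1.52) :
    sin θ * (2 / θ + 8 * θ / (π ^ 2 - θ ^ 2)) < 3 - cos θ := by
  have hP : 9.869 < π ^ 2 := by nlinarith [pi_gt_d4]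
  have hu1 : θ ^ 2 ≤ 2.3104 := by nlinarith
  have hu0 : 0 < θ ^ 2 := by positivity
  have hPu : 0 < π ^ 2 - θ ^ 2 := by linarith
  have hs : sin θ * (2 / θ + 8 * θ / (π ^ 2 - θ ^ 2)) ≤
      (θ - θ ^ 3 / 6 + θ ^ 5 / 120) * (2 / θ + 8 * θ / (π ^ 2 - θ ^ 2)) :=
    mul_le_mul_of_nonneg_right (sin_le_taylor_five h0.le) (by positivity)
  have hc := cos_le_taylor_four h0.le
  have key : (θ - θ ^ 3 / 6 + θ ^ 5 / 120) * (2 / θ + 8 * θ / (π ^ 2 - θ ^ 2)) <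
      2 + θ ^ 2 / 2 - θ ^ 4 / 24 := by
    have e : (θ - θ ^ 3 / 6 + θ ^ 5 / 120) * (2 / θ + 8 * θ / (π ^ 2 - θ ^ 2)) =
        (1 - θ ^ 2 / 6 + (θ ^ 2) ^ 2 / 120) * (2 * π ^ 2 + 6 * θ ^ 2) / (π ^ 2 - θ ^ 2) := by
      field_simp
      ring
    rw [e, div_lt_iff₀ hPu, show θ ^ 4 = (θ ^ 2) ^ 2 by ring]
    generalize θ ^ 2 = u at *
    generalize π ^ 2 = P at *
    have hq : 0 < u * (5 * P / 6 - 8 + (1 / 2 - 7 * P / 120) * u - u ^ 2 / 120) := by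
      apply mul_pos hu0
      nlinarith
    linarith
  linarith

theorem sin_mul_lt_of_le' {δ : ℝ} (h0 : 0 < δ) (h1 : δ ≤ 1.63) :
    sin δ * (2 / (π - δ) + 4 / δ - 4 / (2 * π - δ)) < 3 + cos δ := by
  have hp := pi_gt_d4
  have hd1 : 0 < π - δ := by linarith
  have hd2 : 0 < 2 * π - δ := by linarith
  have e1 : 2 / (π - δ) + 4 / δ - 4 / (2 * π - δ) =
      4 / δ + 2 * δ / ((π - δ) * (2 * π - δ)) := by
    field_simp
    ring
  have hQ : (3.1415 - δ) * (6.283 - δ) ≤ (π - δ) * (2 * π - δ) := by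
    apply mul_le_mul <;> linarith
  have hQ0 : 0 < (π - δ) * (2 * π - δ) := mul_pos hd1 hd2
  rw [e1]
  have hs : sin δ * (4 / δ + 2 * δ / ((π - δ) * (2 * π - δ))) ≤
      (δ - δ ^ 3 / 6 + δ ^ 5 / 120) * (4 / δ + 2 * δ / ((π - δ) * (2 * π - δ))) :=
    mul_le_mul_of_nonneg_right (sin_le_taylor_five h0.le) (by positivity)
  have hc := taylor_six_le_cos h0.le
  have key : (δ - δ ^ 3 / 6 + δ ^ 5 / 120) * (4 / δ + 2 * δ / ((π - δ) * (2 * π - δ))) <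
      4 - δ ^ 2 / 2 + δ ^ 4 / 24 - δ ^ 6 / 720 := by
    generalize (π - δ) * (2 * π - δ) = Q at *
    have e : (δ - δ ^ 3 / 6 + δ ^ 5 / 120) * (4 / δ + 2 * δ / Q) =
        (1 - δ ^ 2 / 6 + δ ^ 4 / 120) * (4 * Q + 2 * δ ^ 2) / Q := by
      field_simp
    rw [e, div_lt_iff₀ hQ0]
    have hv : δ ^ 2 ≤ 2.6569 := by nlinarith
    have hk : 0 < 1 / 6 + δ ^ 2 / 120 - δ ^ 4 / 720 := by nlinarith [sq_nonneg δ]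
    have hpoly : 0 < (3.1415 - δ) * (6.283 - δ) * (1 / 6 + δ ^ 2 / 120 - δ ^ 4 / 720) -
        2 * (1 - δ ^ 2 / 6 + δ ^ 4 / 120) := by
      obtain ⟨t, rfl⟩ : ∃ t, δ = 1.63 - t := ⟨1.63 - δ, by ring⟩
      have ht : 0 ≤ t := by linarith
      have ht1 : t ≤ 1.63 := by linarith
      have h4 : 0 ≤ t ^ 4 * (0.015 - 0.0014 * t ^ 2) := mul_nonneg (by positivity) (by nlinarith)
      nlinarith [pow_nonneg ht 2, pow_nonneg ht 3, pow_nonneg ht 4, pow_nonneg ht 5,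
        pow_nonneg ht 6]
    have hq := mul_le_mul_of_nonneg_right hQ hk.le
    have : 0 < δ ^ 2 * (Q * (1 / 6 + δ ^ 2 / 120 - δ ^ 4 / 720) -
        2 * (1 - δ ^ 2 / 6 + δ ^ 4 / 120)) := mul_pos (by positivity) (by linarith)
    linarith
  linarith

theorem sin_mul_lt {δ : ℝ} (h0 : 0 < δ) (h1 : δ < π) :
    sin δ * (2 / (π - δ) + 4 / δ - 4 / (2 * π - δ)) < 3 + cos δ := by
  rcases le_or_gt δ 1.63 with h | h
  · exact sin_mul_lt_of_le' h0 h
  · have := sin_mul_lt_of_le (θ := π - δ) (by linarith) (by linarith [pi_lt_d4])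
    rw [sin_pi_sub, cos_pi_sub] at this
    have hd1 : π - δ ≠ 0 := by linarith
    have hd2 : 2 * π - δ ≠ 0 := by linarith
    have hd3 : π ^ 2 - (π - δ) ^ 2 ≠ 0 := by
      rw [show π ^ 2 - (π - δ) ^ 2 = δ * (2 * π - δ) by ring]
      exact mul_ne_zero h0.ne' hd2
    convert this using 1
    · congr 1
      rw [show π ^ 2 - (π - δ) ^ 2 = δ * (2 * π - δ) by ring]
      field_simp
      ring
    · ring

/-- The quotient of the derivatives of `1 / sin x` and `1 / (x * (π - x))`. -/
noncomputable def cscRatio (x : ℝ) : ℝ :=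
  (cos x / sin x ^ 2) * (x ^ 2 * (π - x) ^ 2 / (π - 2 * x))

theorem cscRatio_strictAntiOn : StrictAntiOn cscRatio (Set.Ioo 0 (π / 2)) := by
  have hpos : ∀ x ∈ Set.Ioo 0 (π / 2), 0 < sin x ∧ 0 < cos x ∧ 0 < x ∧ 0 < π - x ∧
      0 < π - 2 * x := fun x hx ↦
    ⟨sin_pos_of_pos_of_lt_pi hx.1 (by linarith [hx.2, pi_pos]),
      cos_pos_of_mem_Ioo ⟨by linarith [hx.1, pi_pos], hx.2⟩, hx.1,
      by linarith [hx.2, pi_pos], by linarith [hx.2]⟩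
  let L : ℝ → ℝ := fun x ↦
    log (cos x) - 2 * log (sin x) + 2 * log x + 2 * log (π - x) - log (π - 2 * x)
  have hL : StrictAntiOn L (Set.Ioo 0 (π / 2)) := by
    have hd : ∀ x ∈ Set.Ioo 0 (π / 2), HasDerivAt L (-sin x / cos x - 2 * (cos x / sin x) +
        2 * (1 / x) + 2 * (-1 / (π - x)) - -(2 * 1) / (π - 2 * x)) x := by
      intro x hx
      obtain ⟨hs, hc, h0, h1, h2⟩ := hpos x hx
      exact (((((hasDerivAt_cos x).log hc.ne').sub
        (((hasDerivAt_sin x).log hs.ne').const_mul 2)).add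
        (((hasDerivAt_id' x).log h0.ne').const_mul 2)).add
        ((((hasDerivAt_id' x).const_sub π).log h1.ne').const_mul 2)).sub
        ((((hasDerivAt_id' x).const_mul 2).const_sub π).log h2.ne')
    refine strictAntiOn_of_hasDerivWithinAt_neg (convex_Ioo _ _)
      (fun x hx ↦ (hd x hx).continuousAt.continuousWithinAt)
      (fun x hx ↦ (hd x (interior_subset hx)).hasDerivWithinAt) (fun x hx ↦ ?_)
    obtain ⟨hs, hc, h0, h1, h2⟩ := hpos x (interior_subset hx)
    have key := sin_mul_lt (δ := 2 * x) (by linarith) (by linarith)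
    rw [sin_two_mul, cos_two_mul, show 4 / (2 * x) = 2 / x by field_simp; norm_num,
      show 4 / (2 * π - 2 * x) = 2 / (π - x) by
        rw [← mul_sub]; field_simp; norm_num] at key
    have e : -sin x / cos x - 2 * (cos x / sin x) + 2 * (1 / x) + 2 * (-1 / (π - x)) -
        -(2 * 1) / (π - 2 * x) = (2 * sin x * cos x * (2 / (π - 2 * x) + 2 / x - 2 / (π - x)) -
          2 * (sin x ^ 2 + 2 * cos x ^ 2)) / (2 * sin x * cos x) := by
      field_simp
      ring
    rw [e]
    exact div_neg_of_neg_of_pos (by linarith [sin_sq_add_cos_sq x]) (by positivity)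
  have hlog : ∀ x ∈ Set.Ioo 0 (π / 2), log (cscRatio x) = L x := by
    intro x hx
    obtain ⟨hs, hc, h0, h1, h2⟩ := hpos x hx
    rw [cscRatio, log_mul (by positivity) (by positivity), log_div (by positivity) (by positivity),
      log_div (by positivity) (by positivity), log_mul (by positivity) (by positivity),
      log_pow, log_pow, log_pow]
    simp only [L]
    push_cast
    ring
  have hr : ∀ x ∈ Set.Ioo 0 (π / 2), 0 < cscRatio x := by
    intro x hx
    obtain ⟨hs, hc, h0, h1, h2⟩ := hpos x hx
    unfold cscRatio
    positivity
  intro x hx y hy hxy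
  rw [← log_lt_log_iff (hr y hy) (hr x hx), hlog x hx, hlog y hy]
  exact hL hx hy hxy

theorem exists_cscRatio_mul_eq {x y : ℝ} (hx : 0 < x) (hxy : x < y) (hy : y < π / 2) :
    ∃ c ∈ Set.Ioo x y, cscRatio c * (1 / (x * (π - x)) - 1 / (y * (π - y))) =
      1 / sin x - 1 / sin y := by
  have hpos : ∀ c ∈ Set.Icc x y, 0 < sin c ∧ 0 < c ∧ 0 < π - c ∧ 0 < π - 2 * c := fun c hc ↦
    ⟨sin_pos_of_pos_of_lt_pi (by linarith [hc.1]) (by linarith [hc.2, pi_pos]),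
      by linarith [hc.1], by linarith [hc.2, pi_pos], by linarith [hc.2]⟩
  have hf : ∀ c ∈ Set.Icc x y, HasDerivAt (fun c ↦ 1 / sin c) (-(cos c / sin c ^ 2)) c := by
    intro c hc
    obtain ⟨hs, -⟩ := hpos c hc
    simpa [neg_div] using (hasDerivAt_sin c).fun_inv hs.ne'
  have hg : ∀ c ∈ Set.Icc x y, HasDerivAt (fun c ↦ 1 / (c * (π - c)))
      (-((π - 2 * c) / (c ^ 2 * (π - c) ^ 2))) c := by
    intro c hc
    obtain ⟨-, h0, h1, h2⟩ := hpos c hc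
    have := ((hasDerivAt_id' c).mul ((hasDerivAt_id' c).const_sub π)).fun_inv
      (mul_pos h0 h1).ne'
    simp only [one_div]
    refine this.congr_deriv ?_
    simp only [Pi.mul_apply]
    rw [mul_pow, ← neg_div]
    congr 1
    ring
  obtain ⟨c, hc, h⟩ := exists_ratio_hasDerivAt_eq_ratio_slope _ _ hxy
    (fun c hc ↦ (hf c hc).continuousAt.continuousWithinAt)
    (fun c hc ↦ hf c (Set.Ioo_subset_Icc_self hc)) _ _
    (fun c hc ↦ (hg c hc).continuousAt.continuousWithinAt)
    (fun c hc ↦ hg c (Set.Ioo_subset_Icc_self hc))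
  refine ⟨c, hc, ?_⟩
  obtain ⟨hs, h0, h1, h2⟩ := hpos c (Set.Ioo_subset_Icc_self hc)
  have hk : (π - 2 * c) / (c ^ 2 * (π - c) ^ 2) ≠ 0 := by positivity
  apply mul_right_cancel₀ hk
  have e : cscRatio c * ((π - 2 * c) / (c ^ 2 * (π - c) ^ 2)) = cos c / sin c ^ 2 := by
    rw [cscRatio, mul_assoc, div_mul_div_cancel₀ h2.ne', div_self (by positivity), mul_one]
  linear_combination (1 / (x * (π - x)) - 1 / (y * (π - y))) * e + h

theorem one_div_mul_pi_sub_strictAntiOn :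
    StrictAntiOn (fun x ↦ 1 / (x * (π - x))) (Set.Ioo 0 (π / 2)) := by
  intro x hx y hy hxy
  have h0 : 0 < x * (π - x) := mul_pos hx.1 (by linarith [hx.2, pi_pos])
  exact one_div_lt_one_div_of_lt h0 (by nlinarith [hx.2, hy.2])

theorem angle_le_of_sums_eq {α β α' β' : ℝ}
    (hα : α ∈ Set.Ioo 0 (π / 2)) (hβ : β ∈ Set.Ioo 0 (π / 2)) (hβα : β ≤ α)
    (hα' : α' ∈ Set.Ioo 0 (π / 2)) (hβ' : β' ∈ Set.Ioo 0 (π / 2))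
    (hcsc : 1 / sin α + 1 / sin β = 1 / sin α' + 1 / sin β')
    (hinv : 1 / (α * (π - α)) + 1 / (β * (π - β)) =
      1 / (α' * (π - α')) + 1 / (β' * (π - β'))) : α' ≤ α := by
  by_contra! hlt
  have hg := one_div_mul_pi_sub_strictAntiOn hα hα' hlt
  have hβlt : β' < β := by
    rw [← one_div_mul_pi_sub_strictAntiOn.lt_iff_gt hβ hβ']
    simp only at hg ⊢
    linarith
  obtain ⟨c, hc, h1⟩ := exists_cscRatio_mul_eq hβ'.1 hβlt hβ.2
  obtain ⟨d, hd, h2⟩ := exists_cscRatio_mul_eq hα.1 hlt hα'.2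
  have hr : cscRatio d < cscRatio c :=
    cscRatio_strictAntiOn ⟨hβ'.1.trans hc.1, hc.2.trans hβ.2⟩
      ⟨hα.1.trans hd.1, hd.2.trans hα'.2⟩ (hc.2.trans (hβα.trans_lt hd.1))
  have hm := mul_lt_mul_of_pos_right hr (sub_pos.2 hg)
  have e : 1 / (β' * (π - β')) - 1 / (β * (π - β)) =
      1 / (α * (π - α)) - 1 / (α' * (π - α')) := by linarith
  rw [e] at h1
  simp only at hm
  linarith

theorem corner_invariant_pair {γ : ℝ} (hγ : γ ∈ Set.Ioo 0 (π / 2)) :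
    (π ^ 2 - γ ^ 2) / (24 * π * γ) + (π ^ 2 - (π - γ) ^ 2) / (24 * π * (π - γ)) =
      π ^ 2 / 24 * (1 / (γ * (π - γ))) - 1 / 24 := by
  have h0 : γ ≠ 0 := hγ.1.ne'
  have h1 : π - γ ≠ 0 := by linarith [hγ.2, pi_pos]
  field_simp
  ring

/-- One can hear the shape of an acute trapezoid: two acute trapezoids (top side `b`,
height `h`, base angles `β ≤ α` with `α + β < π/2`, base `B = b + h cot α + h cot β`, legs
`h csc α` and `h csc β`) with the same height, area, perimeter, and heat-trace corner
invariant are congruent. -/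
theorem hear_acute_trapezoid (b h b' h' α β α' β' : ℝ)
    (hb : 0 < b) (hh : 0 < h) (hb' : 0 < b') (hh' : 0 < h')
    (hα : α ∈ Set.Ioo 0 (π / 2)) (hβ : β ∈ Set.Ioo 0 (π / 2)) (hβα : β ≤ α)
    (hα' : α' ∈ Set.Ioo 0 (π / 2)) (hβ' : β' ∈ Set.Ioo 0 (π / 2)) (hβα' : β' ≤ α')
    (hacute : α + β < π / 2) (hacute' : α' + β' < π / 2)
    (hheight : h = h')
    (harea :
      ((b + h * Real.cot α + h * Real.cot β) + b) * h / 2 =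
        ((b' + h' * Real.cot α' + h' * Real.cot β') + b') * h' / 2)
    (hperim :
      (b + h * Real.cot α + h * Real.cot β) + b + h / Real.sin α + h / Real.sin β =
        (b' + h' * Real.cot α' + h' * Real.cot β') + b' + h' / Real.sin α' + h' / Real.sin β')
    (hcorner :
      (π ^ 2 - α ^ 2) / (24 * π * α) + (π ^ 2 - β ^ 2) / (24 * π * β) +
          (π ^ 2 - (π - α) ^ 2) / (24 * π * (π - α)) +
          (π ^ 2 - (π - β) ^ 2) / (24 * π * (π - β)) =
        (π ^ 2 - α' ^ 2) / (24 * π * α') + (π ^ 2 - β' ^ 2) / (24 * π * β') +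
          (π ^ 2 - (π - α') ^ 2) / (24 * π * (π - α')) +
          (π ^ 2 - (π - β') ^ 2) / (24 * π * (π - β'))) :
    b = b' ∧ h = h' ∧ α = α' ∧ β = β' := by
  subst hheight
  have hB : (b + h * Real.cot α + h * Real.cot β) + b =
      (b' + h * Real.cot α' + h * Real.cot β') + b' := by
    apply mul_right_cancel₀ hh.ne'
    linarith
  have hcsc : 1 / sin α + 1 / sin β = 1 / sin α' + 1 / sin β' := by
    apply mul_left_cancel₀ hh.ne'
    simp only [mul_add, mul_one_div]
    linarith
  have hinv : 1 / (α * (π - α)) + 1 / (β * (π - β)) =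
      1 / (α' * (π - α')) + 1 / (β' * (π - β')) := by
    have hk : π ^ 2 / 24 ≠ 0 := by positivity
    apply mul_left_cancel₀ hk
    linarith [corner_invariant_pair hα, corner_invariant_pair hβ, corner_invariant_pair hα',
      corner_invariant_pair hβ']
  have hαα : α = α' := le_antisymm
    (angle_le_of_sums_eq hα' hβ' hβα' hα hβ hcsc.symm hinv.symm)
    (angle_le_of_sums_eq hα hβ hβα hα' hβ' hcsc hinv)
  subst hαα
  have hββ : β = β' := one_div_mul_pi_sub_strictAntiOn.injOn hβ hβ' (add_left_cancel hinv)
  subst hββ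
  exact ⟨by linarith, rfl, rfl, rfl⟩
end

section
/- For every α ∈ (0, π/2], setting t = 1 − α²/6 + α⁴/120, one has t⁴ + (2/3)·α²·t² − 1 ≤ 0; that is, (1 − α²/6 + α⁴/120)⁴ ≤ 1 − (2/3)·α²·(1 − α²/6 + α⁴/120)². -/
/-- The Taylor polynomial `1 - s / 6 + s ^ 2 / 120` of `sin α / α` in `s = α ^ 2` satisfies the
quartic inequality for `0 ≤ s ≤ 5 / 2`. -/
lemma pow_four_taylor_le {s : ℝ} (h₀ : 0 ≤ s) (h₁ : s ≤ 5 / 2) :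
    (1 - s / 6 + s ^ 2 / 120) ^ 4 ≤ 1 - 2 / 3 * s * (1 - s / 6 + s ^ 2 / 120) ^ 2 := by
  have key : 0 ≤ s ^ 2 * (1 / 45 + s * (1 / 180 - (1 / 7200 + 4 / 2025) * s)
      + s ^ 3 * (1 / 4050 - (1 / 162000 + 1 / 129600) * s)
      + s ^ 5 * (1 / 2592000 - 1 / 207360000 * s)) := by
    have hA : 0 ≤ 1 / 180 - (1 / 7200 + 4 / 2025) * s := by linarith
    have hB : 0 ≤ 1 / 4050 - (1 / 162000 + 1 / 129600) * s := by linarith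
    have hC : 0 ≤ 1 / 2592000 - 1 / 207360000 * s := by linarith
    positivity
  linarith

/-- For every `α ∈ (0, π/2]`, setting `t = 1 − α²/6 + α⁴/120` (the degree-five Taylor upper
bound for `sin α / α`), one has `t⁴ + (2/3)α²t² − 1 ≤ 0`. -/
theorem taylor_bound_quartic_ineq (α : ℝ) (hα : α ∈ Set.Ioc 0 (Real.pi / 2)) :
    (1 - α ^ 2 / 6 + α ^ 4 / 120) ^ 4 ≤
      1 - 2 / 3 * α ^ 2 * (1 - α ^ 2 / 6 + α ^ 4 / 120) ^ 2 := by
  have hsq : α ^ 2 ≤ 5 / 2 := by nlinarith [hα.1, hα.2, Real.pi_lt_d2]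
  have h := pow_four_taylor_le (sq_nonneg α) hsq
  rwa [← pow_mul] at h
end

section
/- Let a, b, a', b' be positive real numbers with a ≥ b and a' ≥ b'. Suppose that for every real number t, the number of pairs (m, n) of positive integers with m²/a² + n²/b² ≤ t equals the number of pairs (m, n) of positive integers with m²/a'² + n²/b'² ≤ t. Then a = a' and b = b'. In particular, one can hear the shape of a rectangle: two rectangles whose Dirichlet spectra coincide (counted with multiplicity) are congruent. -/
/-- The positive integer points `(m, n)` with `m² / a² + n² / b² ≤ t`. -/
def ellipsePoints (a b t : ℝ) : Set (ℕ × ℕ) :=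
  {p : ℕ × ℕ | 0 < p.1 ∧ 0 < p.2 ∧ (p.1 : ℝ) ^ 2 / a ^ 2 + (p.2 : ℝ) ^ 2 / b ^ 2 ≤ t}

theorem finite_ellipsePoints {a b : ℝ} (ha : 0 < a) (hb : 0 < b) (t : ℝ) :
    (ellipsePoints a b t).Finite := by
  refine ((Set.finite_Iic ⌊t * a ^ 2⌋₊).prod (Set.finite_Iic ⌊t * b ^ 2⌋₊)).subset ?_
  rintro ⟨m, n⟩ ⟨hm, hn, h⟩
  dsimp only at hm hn h
  have hm1 : (1 : ℝ) ≤ m := by exact_mod_cast hm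
  have hn1 : (1 : ℝ) ≤ n := by exact_mod_cast hn
  have h1 : (m : ℝ) ^ 2 / a ^ 2 ≤ t := le_trans (le_add_of_nonneg_right (by positivity)) h
  have h2 : (n : ℝ) ^ 2 / b ^ 2 ≤ t := le_trans (le_add_of_nonneg_left (by positivity)) h
  rw [div_le_iff₀ (by positivity)] at h1 h2
  exact ⟨Nat.le_floor (by nlinarith), Nat.le_floor (by nlinarith)⟩

theorem ncard_ellipsePoints_pos_iff {a b : ℝ} (ha : 0 < a) (hb : 0 < b) (t : ℝ) :
    0 < (ellipsePoints a b t).ncard ↔ 1 / a ^ 2 + 1 / b ^ 2 ≤ t := by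
  rw [Set.ncard_pos (finite_ellipsePoints ha hb t)]
  constructor
  · rintro ⟨⟨m, n⟩, hm, hn, h⟩
    dsimp only at hm hn h
    have hm1 : (1 : ℝ) ≤ (m : ℝ) ^ 2 := by exact_mod_cast Nat.one_le_pow _ _ hm
    have hn1 : (1 : ℝ) ≤ (n : ℝ) ^ 2 := by exact_mod_cast Nat.one_le_pow _ _ hn
    exact le_trans (by gcongr) h
  · exact fun h => ⟨(1, 1), by simpa [ellipsePoints] using h⟩

theorem one_lt_ncard_ellipsePoints_iff {a b : ℝ} (hb : 0 < b) (hba : b ≤ a) (t : ℝ) :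
    1 < (ellipsePoints a b t).ncard ↔ 4 / a ^ 2 + 1 / b ^ 2 ≤ t := by
  have ha : 0 < a := hb.trans_le hba
  have hinv : 1 / a ^ 2 ≤ 1 / b ^ 2 := by gcongr
  have hpos : 0 < 1 / a ^ 2 := by positivity
  have hfour : 4 / a ^ 2 = 4 * (1 / a ^ 2) := by ring
  rw [Set.one_lt_ncard (finite_ellipsePoints ha hb t)]
  constructor
  · intro h
    obtain ⟨⟨m, n⟩, ⟨hm, hn, h⟩, hne⟩ : ∃ p ∈ ellipsePoints a b t, p ≠ (1, 1) := by
      obtain ⟨p, hp, q, hq, hpq⟩ := h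
      by_cases hp1 : p = (1, 1)
      · exact ⟨q, hq, fun hq1 => hpq (hp1.trans hq1.symm)⟩
      · exact ⟨p, hp, hp1⟩
    dsimp only at hm hn h
    have hm1 : (1 : ℝ) ≤ m := by exact_mod_cast hm
    have hn1 : (1 : ℝ) ≤ n := by exact_mod_cast hn
    have hsum : (m : ℝ) ^ 2 * (1 / a ^ 2) + (n : ℝ) ^ 2 * (1 / b ^ 2) ≤ t := by
      simpa [div_eq_mul_inv] using h
    rw [hfour]
    have hcases : 2 ≤ m ∨ 2 ≤ n := by
      by_contra! hlt
      exact hne (Prod.ext (by dsimp only; omega) (by dsimp only; omega))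
    rcases hcases with h2 | h2
    · have h2 : (2 : ℝ) ≤ m := by exact_mod_cast h2
      have h4 : (4 : ℝ) ≤ (m : ℝ) ^ 2 := by nlinarith
      have h1 : (1 : ℝ) ≤ (n : ℝ) ^ 2 := by nlinarith
      nlinarith
    · have h2 : (2 : ℝ) ≤ n := by exact_mod_cast h2
      have h4 : (4 : ℝ) ≤ (n : ℝ) ^ 2 := by nlinarith
      have h1 : (1 : ℝ) ≤ (m : ℝ) ^ 2 := by nlinarith
      nlinarith
  · intro h
    refine ⟨(1, 1), ⟨by simp, by simp, ?_⟩, (2, 1), ⟨by simp, by simp, ?_⟩, by simp⟩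
    · norm_num only [Nat.cast_one, one_pow]
      linarith
    · push_cast
      norm_num only [one_pow]
      linarith

/-- One can hear the shape of a rectangle: if the Dirichlet eigenvalue counting functions of
two rectangles with side lengths `a ≥ b > 0` and `a' ≥ b' > 0` coincide — i.e., for every
`t` the number of pairs of positive integers `(m, n)` with `m²/a² + n²/b² ≤ t` equals the
number with `m²/a'² + n²/b'² ≤ t` — then the rectangles are congruent: `a = a'` and
`b = b'`. -/
theorem hear_rectangle (a b a' b' : ℝ)
    (hb : 0 < b) (hba : b ≤ a) (hb' : 0 < b') (hba' : b' ≤ a')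
    (hcount : ∀ t : ℝ,
      {p : ℕ × ℕ | 0 < p.1 ∧ 0 < p.2 ∧
          (p.1 : ℝ) ^ 2 / a ^ 2 + (p.2 : ℝ) ^ 2 / b ^ 2 ≤ t}.ncard =
        {p : ℕ × ℕ | 0 < p.1 ∧ 0 < p.2 ∧
          (p.1 : ℝ) ^ 2 / a' ^ 2 + (p.2 : ℝ) ^ 2 / b' ^ 2 ≤ t}.ncard) :
    a = a' ∧ b = b' := by
  have hcard : ∀ t, (ellipsePoints a b t).ncard = (ellipsePoints a' b' t).ncard := hcount
  have ha : 0 < a := hb.trans_le hba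
  have ha' : 0 < a' := hb'.trans_le hba'
  have h1 : 1 / a ^ 2 + 1 / b ^ 2 = 1 / a' ^ 2 + 1 / b' ^ 2 := eq_of_forall_ge_iff fun t => by
    rw [← ncard_ellipsePoints_pos_iff ha hb, ← ncard_ellipsePoints_pos_iff ha' hb', hcard]
  have h2 : 4 / a ^ 2 + 1 / b ^ 2 = 4 / a' ^ 2 + 1 / b' ^ 2 := eq_of_forall_ge_iff fun t => by
    rw [← one_lt_ncard_ellipsePoints_iff hb hba, ← one_lt_ncard_ellipsePoints_iff hb' hba', hcard]
  have hA : (a ^ 2)⁻¹ = (a' ^ 2)⁻¹ := by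
    simp only [div_eq_mul_inv] at h1 h2
    linarith
  have hB : (b ^ 2)⁻¹ = (b' ^ 2)⁻¹ := by
    simp only [div_eq_mul_inv] at h1 h2
    linarith
  exact ⟨(pow_left_inj₀ ha.le ha'.le two_ne_zero).1 (inv_injective hA),
    (pow_left_inj₀ hb.le hb'.le two_ne_zero).1 (inv_injective hB)⟩
end
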